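/- arXiv:1606.05283 — 5 statements merged into one kernel-verified Lean document; each statement's English description precedes it below -/
import Mathlib

section
/- Let n ≥ 2 and 0 ≤ α ≤ 1. Then the following are equivalent: (i) for every unitary U on ℂ^{2^{n+1}}, the state U ρ^α_n U† is separable with respect to the bipartition ℂ² ⊗ ℂ^{2^n} (one qubit versus the remaining n qubits); (ii) α ≥ 1/2. In other words, a DQC1 circuit cannot generate entanglement across any {1; n} bipartition if and only if α ≥ 1/2. -/
open Matrix Kronecker
open scoped ComplexOrder

/-- A bipartite matrix is separable if it is a finite sum of Kronecker products of
positive semidefinite matrices. -/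
def Separable {A B : Type*} [Fintype A] [Fintype B]
    (ρ : Matrix (A × B) (A × B) ℂ) : Prop :=
  ∃ (k : ℕ) (M : Fin k → Matrix A A ℂ) (N : Fin k → Matrix B B ℂ),
    (∀ l, (M l).PosSemidef) ∧ (∀ l, (N l).PosSemidef) ∧ ρ = ∑ l, M l ⊗ₖ N l

/-- The matrix `|0⟩⟨0|`. -/
def ket0bra0 : Matrix (Fin 2) (Fin 2) ℂ :=
  Matrix.of fun i j => if i = 0 ∧ j = 0 then 1 else 0

/-- The DQC1 initial state
`ρᵅₙ = ((1−α)/2ⁿ) |0⟩⟨0| ⊗ₖ I_{2ⁿ} + (α/2ⁿ⁺¹) I_{2ⁿ⁺¹}`. -/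
noncomputable def rhoDQC1 (n : ℕ) (α : ℝ) :
    Matrix (Fin 2 × Fin (2 ^ n)) (Fin 2 × Fin (2 ^ n)) ℂ :=
  (((1 - α : ℝ) : ℂ) / 2 ^ n) • (ket0bra0 ⊗ₖ (1 : Matrix (Fin (2 ^ n)) (Fin (2 ^ n)) ℂ)) +
    ((α : ℂ) / 2 ^ (n + 1)) • (1 : Matrix (Fin 2 × Fin (2 ^ n)) (Fin 2 × Fin (2 ^ n)) ℂ)


lemma dq_sep_of_fintype {A B ι : Type*} [Fintype A] [Fintype B] [Fintype ι]
    (ρ : Matrix (A × B) (A × B) ℂ) (M : ι → Matrix A A ℂ) (N : ι → Matrix B B ℂ)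
    (hM : ∀ l, (M l).PosSemidef) (hN : ∀ l, (N l).PosSemidef)
    (h : ρ = ∑ l, M l ⊗ₖ N l) : Separable ρ := by
  classical
  let e := (Fintype.equivFin ι).symm
  refine ⟨Fintype.card ι, fun l => M (e l), fun l => N (e l), fun l => hM _, fun l => hN _, ?_⟩
  rw [h]
  exact (Equiv.sum_comp e (fun l => M l ⊗ₖ N l)).symm

lemma dq_sep_add {A B : Type*} [Fintype A] [Fintype B]
    {ρ σ : Matrix (A × B) (A × B) ℂ} (h1 : Separable ρ) (h2 : Separable σ) :
    Separable (ρ + σ) := by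
  obtain ⟨k, M, N, hM, hN, rfl⟩ := h1
  obtain ⟨k', M', N', hM', hN', rfl⟩ := h2
  refine dq_sep_of_fintype (ι := Fin k ⊕ Fin k') _ (Sum.elim M M') (Sum.elim N N') ?_ ?_ ?_
  · rintro (l | l) <;> simp [hM, hM']
  · rintro (l | l) <;> simp [hN, hN']
  · simp

lemma dq_sep_kron {A B : Type*} [Fintype A] [Fintype B]
    {M : Matrix A A ℂ} {N : Matrix B B ℂ} (hM : M.PosSemidef) (hN : N.PosSemidef) :
    Separable (M ⊗ₖ N) :=
  dq_sep_of_fintype (ι := Unit) _ (fun _ => M) (fun _ => N) (fun _ => hM) (fun _ => hN) (by simp)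

lemma dq_sep_smul {A B : Type*} [Fintype A] [Fintype B]
    {ρ : Matrix (A × B) (A × B) ℂ} (h1 : Separable ρ) {c : ℝ} (hc : 0 ≤ c) :
    Separable ((c : ℂ) • ρ) := by
  obtain ⟨k, M, N, hM, hN, rfl⟩ := h1
  refine ⟨k, fun l => (c : ℂ) • M l, N, fun l => (hM l).smul (by exact_mod_cast hc), hN, ?_⟩
  rw [Finset.smul_sum]
  simp [Matrix.smul_kronecker]

open scoped Matrix.Norms.L2Operator in
/-- Spectral decomposition of a unitary matrix. -/
lemma dq_unitary_spectral {m : Type*} [Fintype m] [DecidableEq m] (W : Matrix m m ℂ)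
    (hW : W ∈ Matrix.unitaryGroup m ℂ) :
    ∃ (Q : spectrum ℂ W → Matrix m m ℂ), (∀ z, (Q z).PosSemidef) ∧
      (∀ z : spectrum ℂ W, ‖(z : ℂ)‖ = 1) ∧ (∃ _ : Fintype (spectrum ℂ W),
      ∑ z, Q z = 1 ∧ ∑ z : spectrum ℂ W, (z : ℂ) • Q z = W) := by
  classical
  have hfin : (spectrum ℂ W).Finite := Matrix.finite_spectrum W
  have hc : ∀ f : ℂ → ℂ, ContinuousOn f (spectrum ℂ W) := fun f => hfin.continuousOn f
  have hn : IsStarNormal W := by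
    constructor
    have := Matrix.mem_unitaryGroup_iff.1 hW
    have h2 := Matrix.mem_unitaryGroup_iff'.1 hW
    rw [Commute, SemiconjBy, this, h2]
  let _ : Fintype (spectrum ℂ W) := hfin.fintype
  let f : spectrum ℂ W → ℂ → ℂ := fun z x => if x = z then 1 else 0
  refine ⟨fun z => cfc (f z) W, ?_, ?_, inferInstance, ?_, ?_⟩
  · intro z
    have h : cfc (f z) W = (cfc (f z) W)ᴴ * cfc (f z) W := by
      rw [← Matrix.star_eq_conjTranspose, ← cfc_star, ← cfc_mul _ _ _ (hc _) (hc _)]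
      congr 1
      ext x
      simp only [f]
      split_ifs <;> simp
    change (cfc (f z) W).PosSemidef
    rw [h]
    exact Matrix.posSemidef_conjTranspose_mul_self _
  · intro z
    have := spectrum.subset_circle_of_unitary (𝕜 := ℂ) (E := Matrix m m ℂ) hW z.2
    simpa using this
  · rw [← cfc_sum_univ f W (fun i => hc _), ← cfc_const_one ℂ W]
    apply cfc_congr
    intro x hx
    simp only [f, Finset.sum_apply]
    rw [Finset.sum_eq_single ⟨x, hx⟩] <;> simp
    intro a ha h1 h2
    exact absurd h2.symm h1
  · have h : ∀ z : spectrum ℂ W, (z : ℂ) • cfc (f z) W = cfc (fun x => (z : ℂ) • f z x) W :=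
      fun z => (cfc_smul _ _ _ (hc _)).symm
    simp_rw [h]
    conv_rhs => rw [← cfc_id' ℂ W]
    rw [← cfc_sum_univ (fun (z : spectrum ℂ W) x => (z : ℂ) • f z x) W (fun i => hc _)]
    apply cfc_congr
    intro x hx
    simp only [f, Finset.sum_apply]
    rw [Finset.sum_eq_single ⟨x, hx⟩] <;> simp
    intro a ha h1 h2
    exact absurd h2.symm h1

/-- `E_{ii}` -/
def dqE (i : Fin 2) : Matrix (Fin 2) (Fin 2) ℂ := Matrix.diagonal (Pi.single i 1)

lemma dqE_psd (i : Fin 2) : (dqE i).PosSemidef := by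
  apply Matrix.PosSemidef.diagonal
  intro j
  by_cases h : j = i
  · subst h; simp
  · simp [h]

/-- The matrix `[[1, z], [conj z, 1]]` -/
def dqG (z : ℂ) : Matrix (Fin 2) (Fin 2) ℂ := !![1, z; star z, 1]

lemma dqG_psd (z : ℂ) (hz : ‖z‖ = 1) : (dqG z).PosSemidef := by
  have h : dqG z = Matrix.vecMulVec ![z, 1] (star ![z, 1]) := by
    have : z * (starRingEnd ℂ) z = 1 := by rw [Complex.mul_conj']; simp [hz]
    ext i j
    fin_cases i <;> fin_cases j <;> simp [dqG, Matrix.vecMulVec, this]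
  rw [h]
  exact Matrix.posSemidef_vecMulVec_self_star _

/-- Core of the separability direction. -/
lemma dq_core {B : Type*} [Fintype B] [DecidableEq B] (P : Matrix (Fin 2 × B) (Fin 2 × B) ℂ)
    (hP : P.PosSemidef) (hPP : P * P = P) (t : ℝ) (ht0 : 0 ≤ t) (ht : t ≤ 1 / 2) :
    Separable (((1 - t : ℝ) : ℂ) • (1 : Matrix (Fin 2 × B) (Fin 2 × B) ℂ)
      + ((2 * t : ℝ) : ℂ) • P) := by
  classical
  let s : Fin 2 × B ≃ Fin 2 × B := (Equiv.swap 0 1).prodCongr (Equiv.refl B)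
  let H := (2 : ℂ) • P - 1
  have hH : Hᴴ = H := by
    simp [H, Matrix.conjTranspose_sub, Matrix.conjTranspose_smul, hP.1.eq]
  have hHH : H * H = 1 := by
    simp only [H, sub_mul, mul_sub, smul_mul_assoc, mul_smul_comm, hPP, one_mul, mul_one]
    module
  let W := H.submatrix id s
  have hW : W ∈ Matrix.unitaryGroup (Fin 2 × B) ℂ := by
    rw [Matrix.mem_unitaryGroup_iff, Matrix.star_eq_conjTranspose, Matrix.conjTranspose_submatrix,
      hH, Matrix.submatrix_mul_equiv, hHH, Matrix.submatrix_id_id]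
  obtain ⟨Q, hQ, hz, _, h1, h2⟩ := dq_unitary_spectral W hW
  have hsep : Separable (∑ z : spectrum ℂ W, dqG (z : ℂ) ⊗ₖ (Q z).submatrix (Prod.mk 0) (Prod.mk 0)) :=
    dq_sep_of_fintype _ _ _ (fun z : spectrum ℂ W => dqG_psd z (hz z))
      (fun z => (hQ z).submatrix _) rfl
  have e1 : ∀ a b, ∑ z, Q z (0, a) (0, b) = (1 : Matrix B B ℂ) a b := by
    intro a b
    have := congrFun (congrFun h1 (0, a)) (0, b)
    rw [Matrix.sum_apply] at this
    rw [this]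
    simp [Matrix.one_apply]
  have e2 : ∀ a b, ∑ z : spectrum ℂ W, (z : ℂ) * Q z (0, a) (0, b) = 2 * P (0, a) (1, b) := by
    intro a b
    have := congrFun (congrFun h2 (0, a)) (0, b)
    rw [Matrix.sum_apply] at this
    simp only [Matrix.smul_apply, smul_eq_mul] at this
    rw [this]
    simp [W, H, s]
  have e3 : ∀ a b, ∑ z : spectrum ℂ W, star (z : ℂ) * Q z (0, a) (0, b) = 2 * P (1, a) (0, b) := by
    intro a b
    have := congrArg star (e2 b a)
    rw [star_sum] at this
    simp only [star_mul'] at this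
    rw [show star (P (0, b) (1, a)) = P (1, a) (0, b) from hP.1.apply _ _] at this
    rw [show (2 : ℂ) = star (2 : ℂ) by simp, ← this]
    refine Finset.sum_congr rfl fun z _ => ?_
    rw [show star (Q z (0, b) (0, a)) = Q z (0, a) (0, b) from (hQ z).1.apply _ _]
  have e3' : ∀ a b, ∑ z : spectrum ℂ W, (starRingEnd ℂ) (z : ℂ) * Q z (0, a) (0, b) =
      2 * P (1, a) (0, b) := e3
  have key := dq_sep_add (dq_sep_add (dq_sep_smul (dq_sep_add
      (dq_sep_kron (dqE_psd 0) (hP.submatrix (Prod.mk (0 : Fin 2))))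
      (dq_sep_kron (dqE_psd 1) (hP.submatrix (Prod.mk (1 : Fin 2)))))
        (show 0 ≤ 2 * t by linarith))
      (dq_sep_smul (dq_sep_kron (Matrix.PosSemidef.one (n := Fin 2) (R := ℂ))
        (Matrix.PosSemidef.one (n := B) (R := ℂ))) (show 0 ≤ 1 - 2 * t by linarith)))
      (dq_sep_smul hsep ht0)
  convert key using 1
  ext ⟨i, a⟩ ⟨j, b⟩
  simp only [Matrix.add_apply, Matrix.smul_apply, Matrix.sum_apply, Matrix.kroneckerMap_apply,
    Matrix.submatrix_apply, smul_eq_mul]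
  fin_cases i <;> fin_cases j <;>
    simp [dqG, dqE, e1, e2, e3', Matrix.one_apply] <;>
    (try split_ifs) <;> (try push_cast) <;> ring

lemma dq_necess {B : Type*} [Fintype B] [DecidableEq B] (ρ : Matrix (Fin 2 × B) (Fin 2 × B) ℂ)
    (h : Separable ρ) (a b : B) :
    0 ≤ ρ (0, a) (0, a) + ρ (1, b) (1, b) + ρ (0, b) (1, a) + ρ (1, a) (0, b) := by
  obtain ⟨k, M, N, hM, hN, rfl⟩ := h
  simp only [Matrix.sum_apply, ← Finset.sum_add_distrib]
  refine Finset.sum_nonneg fun l _ => ?_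
  have hp := ((hM l).kronecker ((hN l).transpose.submatrix ![a, b]))
  have := hp.dotProduct_mulVec_nonneg (fun x => if x.1 = x.2 then 1 else 0)
  simp [dotProduct, Matrix.mulVec, Fintype.sum_prod_type, Fin.sum_univ_two,
    Matrix.kroneckerMap_apply, -Matrix.submatrix_cons_row] at this
  simp only [Matrix.kroneckerMap_apply]
  convert this using 1
  ring

lemma dq_rho_diag (n : ℕ) (α : ℝ) : rhoDQC1 n α =
    Matrix.diagonal (fun x => if x.1 = 0 then (((2 - α) / 2 ^ (n + 1) : ℝ) : ℂ)
      else ((α / 2 ^ (n + 1) : ℝ) : ℂ)) := by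
  ext ⟨i, a⟩ ⟨j, b⟩
  simp only [rhoDQC1, ket0bra0, Matrix.add_apply, Matrix.smul_apply, Matrix.kroneckerMap_apply,
    Matrix.one_apply, Matrix.diagonal_apply, Matrix.of_apply, smul_eq_mul, Prod.mk.injEq]
  by_cases hab : a = b
  · fin_cases i <;> fin_cases j <;> simp [hab]
    rw [pow_succ]
    field_simp
    ring
  · simp [hab]

lemma dq_sum_two {m : Type*} [Fintype m] [DecidableEq m] (p q : m) (hpq : p ≠ q) (a b : ℂ)
    (f : m → ℂ) :
    ∑ k, (if k = p then a else if k = q then b else 0) * f k = a * f p + b * f q := by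
  rw [Finset.sum_eq_add p q hpq]
  · simp [hpq.symm]
  · intro k _ hk
    simp [hk.1, hk.2]
  · simp
  · simp

lemma dq_sum_one {m : Type*} [Fintype m] [DecidableEq m] (p : m) (f : m → ℂ) :
    ∑ k, (if k = p then (1 : ℂ) else 0) * f k = f p := by
  simp

/-- A rotation-reflection in the plane spanned by two basis vectors. -/
lemma dq_refl {m : Type*} [Fintype m] [DecidableEq m] (p q : m) (hpq : p ≠ q) :
    ∃ R : Matrix m m ℂ, R * Rᴴ = 1 ∧ (∀ x, x ≠ p → x ≠ q → ∀ y, R x y = if y = x then 1 else 0) ∧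
      ∃ c : ℝ, c * c = 1 / 2 ∧
      (∀ y, R p y = if y = p then (c : ℂ) else if y = q then -(c : ℂ) else 0) ∧
      (∀ y, R q y = if y = p then -(c : ℂ) else if y = q then -(c : ℂ) else 0) := by
  let c : ℝ := Real.sqrt (1 / 2)
  have hc : c * c = 1 / 2 := Real.mul_self_sqrt (by norm_num)
  have hcc : (c : ℂ) * c = 1 / 2 := by
    rw [← Complex.ofReal_mul, hc]; norm_num
  have hqp := hpq.symm
  let R : Matrix m m ℂ := Matrix.of fun x y =>
    if x = p then (if y = p then (c : ℂ) else if y = q then -(c : ℂ) else 0)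
    else if x = q then (if y = p then -(c : ℂ) else if y = q then -(c : ℂ) else 0)
    else if y = x then 1 else 0
  have hx : ∀ x, x ≠ p → x ≠ q → ∀ y, R x y = if y = x then 1 else 0 := by
    intro x hp hq y
    simp [R, hp, hq]
  have hp : ∀ y, R p y = if y = p then (c : ℂ) else if y = q then -(c : ℂ) else 0 := by
    intro y; simp [R]
  have hq : ∀ y, R q y = if y = p then -(c : ℂ) else if y = q then -(c : ℂ) else 0 := by
    intro y; simp [R, hqp]
  refine ⟨R, ?_, hx, c, hc, hp, hq⟩
  ext x y
  rw [Matrix.mul_apply, Matrix.one_apply]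
  simp only [Matrix.conjTranspose_apply]
  have hy : star (R y p) = (if y = p then (c : ℂ) else if y = q then -(c : ℂ) else 0) ∧
      star (R y q) = (if y = p then -(c : ℂ) else if y = q then -(c : ℂ) else 0) := by
    by_cases hyp : y = p
    · subst hyp; simp [hp, hqp]
    · by_cases hyq : y = q
      · subst hyq; simp [hq, hqp]
      · simp [hx y hyp hyq, hyp, hyq, Ne.symm hyp, Ne.symm hyq]
  by_cases hxp : x = p
  · subst hxp
    simp only [hp]
    rw [dq_sum_two _ _ hpq, hy.1, hy.2]
    by_cases hyp : y = x
    · subst hyp; simp [hcc]; norm_num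
    · by_cases hyq : y = q
      · subst hyq; simp [hpq, hqp]
      · simp [hyp, hyq, Ne.symm hyp]
  · by_cases hxq : x = q
    · subst hxq
      simp only [hq]
      rw [dq_sum_two _ _ hpq, hy.1, hy.2]
      by_cases hyp : y = p
      · subst hyp; simp [hxp]
      · by_cases hyq : y = x
        · subst hyq; simp [hxp, hcc]; norm_num
        · simp [hyp, hyq, Ne.symm hyq]
    · simp only [hx x hxp hxq]
      rw [dq_sum_one]
      by_cases hyp : y = p
      · subst hyp; simp [hp, hxp, hxq]
      · by_cases hyq : y = q
        · subst hyq; simp [hq, hxp, hxq]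
        · simp [hx y hyp hyq]

/-- for `n ≥ 2` and `0 ≤ α ≤ 1`, every unitary conjugate `U ρᵅₙ U†` is
separable with respect to the one-qubit-versus-`n`-qubits bipartition
`ℂ² ⊗ ℂ^{2ⁿ}` if and only if `α ≥ 1/2`. -/
theorem stmt4 (n : ℕ) (hn : 2 ≤ n) (α : ℝ) (h0 : 0 ≤ α) (h1 : α ≤ 1) :
    (∀ U ∈ Matrix.unitaryGroup (Fin 2 × Fin (2 ^ n)) ℂ,
        Separable (U * rhoDQC1 n α * Uᴴ)) ↔ 1 / 2 ≤ α := by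
  
  constructor
  · intro h
    have h3 : 3 ≤ 2 ^ n := le_trans (by norm_num) (Nat.pow_le_pow_right (by norm_num : 0 < 2) hn)
    let f0 : Fin (2 ^ n) := ⟨0, by omega⟩
    let f1 : Fin (2 ^ n) := ⟨1, by omega⟩
    let f2 : Fin (2 ^ n) := ⟨2, by omega⟩
    have h01 : f0 ≠ f1 := by simp [f0, f1]
    have h02 : f0 ≠ f2 := by simp [f0, f2]
    have h12 : f1 ≠ f2 := by simp [f1, f2]
    let τ : Equiv.Perm (Fin 2 × Fin (2 ^ n)) :=
      Equiv.swap (0, f1) (0, f0) * Equiv.swap (0, f0) (1, f2)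
    have t00 : τ (0, f0) = (1, f2) := by
      simp [τ, Equiv.swap_apply_def]
    have t01 : τ (0, f1) = (0, f0) := by
      simp [τ, Equiv.swap_apply_def, h01.symm]
    have t10 : τ (1, f0) = (1, f0) := by
      simp [τ, Equiv.swap_apply_def, h02]
    have t11 : τ (1, f1) = (1, f1) := by
      simp [τ, Equiv.swap_apply_def, h12]
    obtain ⟨R, hR, hx, c, hc, hp, hq⟩ := dq_refl ((0, f1) : Fin 2 × Fin (2 ^ n)) (1, f0) (by simp)
    have hcc : (c : ℂ) * c = 1 / 2 := by
      rw [← Complex.ofReal_mul, hc]; norm_num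
    have hU : R.submatrix id τ.symm ∈ Matrix.unitaryGroup (Fin 2 × Fin (2 ^ n)) ℂ := by
      rw [Matrix.mem_unitaryGroup_iff, Matrix.star_eq_conjTranspose,
        Matrix.conjTranspose_submatrix, Matrix.submatrix_mul_equiv, hR, Matrix.submatrix_id_id]
    have hs := h _ hU
    rw [dq_rho_diag] at hs
    set d : Fin 2 × Fin (2 ^ n) → ℂ := (fun x => if x.1 = 0 then (((2 - α) / 2 ^ (n + 1) : ℝ) : ℂ)
      else ((α / 2 ^ (n + 1) : ℝ) : ℂ)) with hd
    have hent : ∀ x y, (R.submatrix id τ.symm * Matrix.diagonal d *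
        (R.submatrix id τ.symm)ᴴ) x y = ∑ k, R x k * (d (τ k) * star (R y k)) := by
      intro x y
      rw [Matrix.mul_apply, ← Equiv.sum_comp τ]
      simp [Matrix.mul_diagonal, mul_assoc]
    have hn := dq_necess _ hs f0 f1
    have hx0 := hx (0, f0) (by simp [h01]) (by simp)
    have hx1 := hx (1, f1) (by simp) (by simp [h01.symm])
    have hne : ((0, f1) : Fin 2 × Fin (2 ^ n)) ≠ (1, f0) := by simp
    rw [hent, hent, hent, hent, Finset.sum_congr rfl (fun k _ => by rw [hx0 k]),
      dq_sum_one, Finset.sum_congr rfl (fun k _ => by rw [hx1 k]), dq_sum_one,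
      Finset.sum_congr rfl (fun k _ => by rw [hp k]), dq_sum_two _ _ hne,
      Finset.sum_congr rfl (fun k _ => by rw [hq k]), dq_sum_two _ _ hne] at hn
    rw [hp, hp, hq, hq, t00, t01, t10, t11] at hn
    simp only [hd, if_neg hne.symm, if_true, Fin.isValue, one_ne_zero, if_false, star_neg, star_one,
      RCLike.star_def, Complex.conj_ofReal] at hn
    have hpos : (0 : ℂ) ≤ (((4 * α - 2) / 2 ^ (n + 1) : ℝ) : ℂ) := by
      convert hn using 1
      push_cast
      linear_combination (2 * (2 - 2 * α) / 2 ^ (n + 1) : ℂ) * hcc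
    have hre : 0 ≤ (4 * α - 2) / 2 ^ (n + 1) := by exact_mod_cast hpos
    have h4 : 0 ≤ 4 * α - 2 := by
      by_contra hlt
      push Not at hlt
      exact absurd hre (not_le.2 (div_neg_of_neg_of_pos hlt (by positivity)))
    linarith
  · intro h U hU
    have hUU : U * Uᴴ = 1 := Matrix.mem_unitaryGroup_iff.1 hU
    have hUU' : Uᴴ * U = 1 := Matrix.mem_unitaryGroup_iff'.1 hU
    let P0 : Matrix (Fin 2 × Fin (2 ^ n)) (Fin 2 × Fin (2 ^ n)) ℂ :=
      Matrix.diagonal (fun x => if x.1 = 0 then 1 else 0)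
    have hP0 : P0.PosSemidef := by
      apply Matrix.PosSemidef.diagonal
      intro x
      by_cases hx : x.1 = 0 <;> simp [hx]
    have hPP0 : P0 * P0 = P0 := by simp [P0, Matrix.diagonal_mul_diagonal]
    have hrho : rhoDQC1 n α = ((1 / 2 ^ (n + 1) : ℝ) : ℂ) • (((1 - (1 - α) : ℝ) : ℂ) •
        (1 : Matrix (Fin 2 × Fin (2 ^ n)) (Fin 2 × Fin (2 ^ n)) ℂ) +
        ((2 * (1 - α) : ℝ) : ℂ) • P0) := by
      rw [dq_rho_diag]
      ext x y
      simp only [P0, Matrix.add_apply, Matrix.smul_apply, Matrix.one_apply, Matrix.diagonal_apply,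
        smul_eq_mul]
      by_cases hxy : x = y <;> by_cases hx : x.1 = 0 <;> simp [hxy, hx] <;> 
        (try simp_all) <;> (try field_simp) <;> (try ring)
    have := dq_sep_smul (dq_core (U * P0 * Uᴴ) (hP0.mul_mul_conjTranspose_same U) (by
        rw [show U * P0 * Uᴴ * (U * P0 * Uᴴ) = U * P0 * (Uᴴ * U) * P0 * Uᴴ by
          simp only [Matrix.mul_assoc], hUU', Matrix.mul_one, Matrix.mul_assoc U P0 P0, hPP0])
        (1 - α) (by linarith) (by linarith)) (show (0 : ℝ) ≤ 1 / 2 ^ (n + 1) by positivity)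
    convert this using 1
    rw [hrho]
    simp only [Matrix.mul_smul, Matrix.smul_mul, Matrix.mul_add, Matrix.add_mul, Matrix.mul_one, hUU]
end

section
/- Let m < n be natural numbers and λ₊ ≥ λ₋ ≥ 0. Let τ be a positive semidefinite trace-one matrix on ℂ^{2^m} ⊗ ℂ^{2^n} whose largest eigenvalue equals λ₊ with multiplicity at least 2^{2m−1} − 2^{m−1} and whose smallest eigenvalue equals λ₋ with multiplicity at least 2^{2m−1} + 2^{m−1}. Then τ is PPT from spectrum for the 2^m : 2^n bipartition (i.e. for every unitary U on ℂ^{2^{m+n}}, the partial transpose on the first factor of U τ U† is positive semidefinite) if and only if ½(λ₊ + λ₋) − 2^{m−1}(λ₊ − λ₋) ≥ 0. -/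
open Matrix
open scoped ComplexOrder

/-- Partial transpose on the first factor of a bipartite matrix. -/
def PT {A B : Type*} (M : Matrix (A × B) (A × B) ℂ) : Matrix (A × B) (A × B) ℂ :=
  Matrix.of fun p q => M (q.1, p.2) (p.1, q.2)

section
variable {A B : Type*} [Fintype A] [Fintype B] [DecidableEq A] [DecidableEq B]

def RR (M : Matrix (A × B) (A × B) ℂ) : Matrix (A × B) (A × B) ℂ :=
  Matrix.of fun p q => if p.1 = q.1 then ∑ a, M (a, p.2) (a, q.2) else 0

def SS (k i : A) : Matrix (A × B) (A × B) ℂ :=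
  Matrix.of fun p q => if q.1 = i then (if p = (k, q.2) then 1 else 0) else 0

lemma SS_apply (M : Matrix (A × B) (A × B) ℂ) (k i k' i' : A) (x y : A × B) :
    ((SS k i : Matrix (A × B) (A × B) ℂ)ᴴ * M * (SS k' i' : Matrix (A × B) (A × B) ℂ)) x y
      = if x.1 = i then if y.1 = i' then M (k, x.2) (k', y.2) else 0 else 0 := by
  simp only [Matrix.mul_apply, SS, Matrix.conjTranspose_apply, Matrix.of_apply]
  by_cases h : x.1 = i <;> by_cases h' : y.1 = i' <;> simp [h, h']

lemma RR_PT (M : Matrix (A × B) (A × B) ℂ) (ε : ℂ) (h1 : star ε = ε) (h2 : ε * ε = 1) :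
    ∑ k : A, ∑ i : A, ((SS k i + ε • SS i k : Matrix (A × B) (A × B) ℂ)ᴴ * M * (SS k i + ε • SS i k))
      = (2 : ℝ) • (RR M + ε • PT M) := by
  ext x y
  simp only [Matrix.conjTranspose_add, Matrix.conjTranspose_smul, h1, Matrix.add_mul, Matrix.mul_add,
    Matrix.smul_mul, Matrix.mul_smul, Matrix.sum_apply, Matrix.add_apply, Matrix.smul_apply, SS_apply,
    RR, PT, Matrix.of_apply, smul_add, smul_smul, h2, one_mul, one_smul, smul_eq_mul,
    Finset.sum_add_distrib]
  obtain ⟨x1, x2⟩ := x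
  obtain ⟨y1, y2⟩ := y
  by_cases h : x1 = y1
  · subst h
    simp [Finset.sum_ite_eq, ← Finset.mul_sum, two_smul]
    ring
  · have h' : ¬ y1 = x1 := fun e => h e.symm
    simp [h, h', two_smul, ← Finset.mul_sum]

lemma RR_PT_psd {M : Matrix (A × B) (A × B) ℂ} (hM : M.PosSemidef) (ε : ℂ) (h1 : star ε = ε)
    (h2 : ε * ε = 1) : (RR M + ε • PT M).PosSemidef := by
  have h := RR_PT M ε h1 h2
  have h3 : (∑ k : A, ∑ i : A, ((SS k i + ε • SS i k : Matrix (A × B) (A × B) ℂ)ᴴ * M *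
      (SS k i + ε • SS i k))).PosSemidef :=
    Matrix.posSemidef_sum _ fun k _ => Matrix.posSemidef_sum _ fun i _ =>
      hM.conjTranspose_mul_mul_same _
  rw [h] at h3
  have := h3.smul (show (0 : ℝ) ≤ 1/2 by norm_num)
  rwa [smul_smul, show (1/2 : ℝ) * 2 = 1 by norm_num, one_smul] at this

lemma PT_psd {M : Matrix (A × B) (A × B) ℂ} {lp lm : ℝ} (hm : (M - lm • 1).PosSemidef)
    (hp : (lp • 1 - M).PosSemidef)
    (h : 0 ≤ lm * (1 + Fintype.card A) + lp * (1 - Fintype.card A)) : (PT M).PosSemidef := by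
  have a := RR_PT_psd hm 1 (by simp) (by simp)
  have b := RR_PT_psd hp (-1) (by simp) (by simp)
  have c : ((lm * (1 + Fintype.card A) + lp * (1 - Fintype.card A)) •
    (1 : Matrix (A × B) (A × B) ℂ)).PosSemidef := Matrix.PosSemidef.one.smul h
  have d := ((a.add b).add c).smul (show (0 : ℝ) ≤ 1/2 by norm_num)
  convert d using 1
  ext x y
  obtain ⟨x1, x2⟩ := x
  obtain ⟨y1, y2⟩ := y
  simp only [RR, PT, Matrix.of_apply, Matrix.add_apply, Matrix.sub_apply, Matrix.smul_apply,
    Matrix.one_apply, Prod.mk.injEq, Finset.sum_sub_distrib]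
  by_cases h : x1 = y1
  · subst h
    by_cases h' : x2 = y2
    · simp [h']
      ring
    · simp [h']
      ring
  · have h' : ¬ y1 = x1 := fun e => h e.symm
    simp [h, h']
    ring
end

section
variable {X : Type*} [Fintype X] [DecidableEq X]

lemma exists_perm (d : X → ℝ) (lp lm : ℝ) (hne : lm ≠ lp) (A B : Finset X) (hAB : Disjoint A B)
    (hA : A.card ≤ {i | d i = lp}.ncard) (hB : B.card ≤ {i | d i = lm}.ncard) :
    ∃ π : X ≃ X, (∀ x ∈ A, d (π x) = lp) ∧ ∀ x ∈ B, d (π x) = lm := by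
  classical
  obtain ⟨f⟩ : Nonempty (A ↪ {i | d i = lp}) := Function.Embedding.nonempty_of_card_le (by
    simpa [Set.ncard_eq_toFinset_card', Fintype.card_subtype] using hA)
  obtain ⟨g⟩ : Nonempty (B ↪ {i | d i = lm}) := Function.Embedding.nonempty_of_card_le (by
    simpa [Set.ncard_eq_toFinset_card', Fintype.card_subtype] using hB)
  let F : X → X := fun x => if h : x ∈ A then f ⟨x, h⟩ else if h' : x ∈ B then g ⟨x, h'⟩ else x
  have FA : ∀ x ∈ A, d (F x) = lp := fun x hx => by
    simp only [F, hx, dif_pos]; exact (f ⟨x, hx⟩).2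
  have FB : ∀ x ∈ B, d (F x) = lm := fun x hx => by
    have : x ∉ A := fun h => (Finset.disjoint_left.1 hAB h hx)
    simp only [F, hx, this, dif_pos]; exact (g ⟨x, hx⟩).2
  obtain ⟨e, he⟩ := Finset.exists_equiv_extend_of_card_eq (α := X) (t := (Finset.univ : Finset X))
    (by simp) (s := A ∪ B) (f := F) (by simp) (by
      intro x hx y hy hxy
      simp only [Finset.coe_union, Set.mem_union, Finset.mem_coe] at hx hy
      rcases hx with hx | hx <;> rcases hy with hy | hy
      · simp only [F, hx, hy, dif_pos] at hxy
        simpa using f.injective (Subtype.ext hxy)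
      · exact absurd ((FB y hy).symm.trans (by rw [← hxy]; exact FA x hx)) hne
      · exact absurd ((FB x hx).symm.trans (by rw [hxy]; exact FA y hy)) hne
      · have hx' : x ∉ A := fun h => (Finset.disjoint_left.1 hAB h hx)
        have hy' : y ∉ A := fun h => (Finset.disjoint_left.1 hAB h hy)
        simp only [F, hx, hy, hx', hy', dif_pos] at hxy
        simpa using g.injective (Subtype.ext hxy))
  refine ⟨e.trans (Equiv.subtypeUnivEquiv (by simp)), fun x hx => ?_, fun x hx => ?_⟩
  · have := he x (Finset.mem_union_left _ hx)
    simp [this, FA x hx]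
  · have := he x (Finset.mem_union_right _ hx)
    simp [this, FB x hx]

/-- the rotation matrix -/
def QQ (s : X → X) (c t : X → ℝ) : Matrix X X ℂ :=
  Matrix.of fun x y => (if y = x then (c x : ℂ) else 0) + (if y = s x then (t x : ℂ) else 0)

lemma QQ_herm (s : X → X) (c t : X → ℝ) (hs : ∀ x, s (s x) = x) (ht : ∀ x, t (s x) = t x) :
    (QQ s c t)ᴴ = QQ s c t := by
  ext x y
  simp only [QQ, Matrix.conjTranspose_apply, Matrix.of_apply, star_add]
  congr 1
  · by_cases h : x = y
    · subst h; simp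
    · simp [h, Ne.symm h]
  · by_cases h : x = s y
    · subst h; simp [hs, ht]
    · have : ¬ y = s x := fun e => h (by rw [e, hs])
      simp [h, this]

lemma QQ_sq (s : X → X) (c t : X → ℝ) (hs : ∀ x, s (s x) = x)
    (ht : ∀ x, t (s x) = t x) (h1 : ∀ x, c x * c x + t x * t x = 1)
    (h2 : ∀ x, c x * t x + t x * c (s x) = 0) : QQ s c t * QQ s c t = 1 := by
  ext x z
  have h1' : (c x : ℂ) * c x + t x * t x = 1 := by exact_mod_cast h1 x
  have h2' : (c x : ℂ) * t x + t x * c (s x) = 0 := by exact_mod_cast h2 x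
  simp only [QQ, Matrix.mul_apply, Matrix.of_apply, Matrix.one_apply, add_mul, ite_mul, zero_mul,
    Finset.sum_add_distrib, Finset.sum_ite_eq', Finset.mem_univ, if_true, hs, ht, mul_add]
  by_cases h : z = x
  · by_cases h' : z = s x
    · simp only [if_pos h, if_pos h', if_pos h.symm]
      linear_combination h1' + h2'
    · simp only [if_pos h, if_neg h', if_pos h.symm]
      linear_combination h1'
  · by_cases h' : z = s x
    · simp only [if_neg h, if_pos h', if_neg (Ne.symm h)]
      linear_combination h2'
    · simp only [if_neg h, if_neg h', if_neg (Ne.symm h)]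
      ring

lemma QQ_conj (s : X → X) (c t : X → ℝ) (hs : ∀ x, s (s x) = x)
    (ht : ∀ x, t (s x) = t x) (g : X → ℝ) (x : X) :
    (QQ s c t * Matrix.diagonal (fun i => (g i : ℂ)) * QQ s c t) x (s x) =
     if s x = x then (((c x + t x) * g x * (c x + t x) : ℝ) : ℂ)
     else ((c x * g x * t x + t x * g (s x) * c (s x) : ℝ) : ℂ) := by
  rw [Matrix.mul_assoc, Matrix.mul_apply]
  simp only [Matrix.diagonal_mul, QQ, Matrix.of_apply, add_mul, ite_mul, zero_mul,
    Finset.sum_add_distrib, Finset.sum_ite_eq', Finset.mem_univ, if_true, hs, ht]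
  by_cases h : s x = x
  · simp [h]; ring
  · simp [h, Ne.symm h]; ring
end

section
variable {p N : ℕ}

/-- the swap on the `p × p` corner -/
def sw (hpN : p ≤ N) (x : Fin p × Fin N) : Fin p × Fin N :=
  if h : x.2.val < p then (⟨x.2, h⟩, ⟨x.1, lt_of_lt_of_le x.1.2 hpN⟩) else x

lemma sw_sw (hpN : p ≤ N) (x : Fin p × Fin N) : sw hpN (sw hpN x) = x := by
  unfold sw
  by_cases h : x.2.val < p
  · simp [h]
  · simp [h]

lemma sw_mk (hpN : p ≤ N) (k i : Fin p) :
    sw hpN (k, Fin.castLE hpN i) = (i, Fin.castLE hpN k) := by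
  simp [sw]; rfl

lemma sw_ne (hpN : p ≤ N) {x : Fin p × Fin N} (h : sw hpN x ≠ x) :
    ∃ k i : Fin p, k ≠ i ∧ x = (k, Fin.castLE hpN i) := by
  by_cases h2 : x.2.val < p
  · refine ⟨x.1, ⟨x.2, h2⟩, ?_, rfl⟩
    intro e
    apply h
    unfold sw
    rw [dif_pos h2]
    ext
    · simp [e]
    · simp [e]
  · exact absurd (by simp [sw, h2]) h

open Classical in
/-- diagonal coefficients -/
noncomputable def cc (hpN : p ≤ N) (x : Fin p × Fin N) : ℝ :=
  if sw hpN x = x then 1 else if x.1.val < x.2.val then √(1/2) else -√(1/2)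

open Classical in
/-- swap coefficients -/
noncomputable def tt (hpN : p ≤ N) (x : Fin p × Fin N) : ℝ :=
  if sw hpN x = x then 0 else √(1/2)

lemma rr : √(1/2 : ℝ) * √(1/2) = 1/2 := Real.mul_self_sqrt (by norm_num)

lemma tt_sw (hpN : p ≤ N) (x : Fin p × Fin N) : tt hpN (sw hpN x) = tt hpN x := by
  unfold tt
  rw [sw_sw]
  by_cases h : sw hpN x = x
  · simp [h]
  · simp [h, Ne.symm h]

lemma cc_sw (hpN : p ≤ N) (x : Fin p × Fin N) (h : sw hpN x ≠ x) :
    cc hpN (sw hpN x) = - cc hpN x := by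
  unfold cc
  rw [sw_sw, if_neg h, if_neg h.symm]
  obtain ⟨k, i, hki, rfl⟩ := sw_ne hpN h
  have : k.val ≠ i.val := fun e => hki (Fin.ext e)
  simp only [sw_mk, Fin.val_castLE]
  rcases lt_or_gt_of_ne this with h | h
  · simp [h, h.le, not_lt.2 h.le]
  · simp [h, h.le, not_lt.2 h.le]

lemma cc_tt1 (hpN : p ≤ N) (x : Fin p × Fin N) :
    cc hpN x * cc hpN x + tt hpN x * tt hpN x = 1 := by
  have := rr
  unfold cc tt
  split_ifs <;> linarith

lemma cc_tt2 (hpN : p ≤ N) (x : Fin p × Fin N) :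
    cc hpN x * tt hpN x + tt hpN x * cc hpN (sw hpN x) = 0 := by
  by_cases h : sw hpN x = x
  · simp [tt, h]
  · rw [cc_sw hpN x h]; ring

lemma conj_val (hpN : p ≤ N) (g : Fin p × Fin N → ℝ) (lp lm : ℝ)
    (hA : ∀ k i : Fin p, i < k → g (k, Fin.castLE hpN i) = lp)
    (hB : ∀ k i : Fin p, k ≤ i → g (k, Fin.castLE hpN i) = lm) (k i : Fin p) :
    (QQ (sw hpN) (cc hpN) (tt hpN) * Matrix.diagonal (fun i => (g i : ℂ)) *
      QQ (sw hpN) (cc hpN) (tt hpN)) (k, Fin.castLE hpN i) (i, Fin.castLE hpN k)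
     = (((lm - lp) / 2 + if k = i then (lm + lp) / 2 else 0 : ℝ) : ℂ) := by
  have h := QQ_conj (sw hpN) (cc hpN) (tt hpN) (sw_sw hpN) (tt_sw hpN) g (k, Fin.castLE hpN i)
  have h4 := rr
  rw [sw_mk] at h
  rw [h]
  by_cases hki : k = i
  · subst hki
    have h1 : sw hpN (k, Fin.castLE hpN k) = (k, Fin.castLE hpN k) := sw_mk hpN k k
    rw [if_pos rfl, if_pos rfl, hB k k le_rfl]
    simp only [cc, tt, h1, if_true]
    congr 1
    ring
  · have h0 : ¬ (i, Fin.castLE hpN k) = (k, Fin.castLE hpN i) := fun e => hki (Prod.ext_iff.1 e).1.symm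
    have h1 : sw hpN (k, Fin.castLE hpN i) ≠ (k, Fin.castLE hpN i) := by
      rw [sw_mk]; exact h0
    rw [if_neg h0, if_neg hki]
    have h3 := cc_sw hpN _ h1
    rw [sw_mk] at h3
    rw [h3]
    congr 1
    simp only [tt, cc, if_neg h1, Fin.val_castLE]
    rcases lt_or_gt_of_ne hki with hl | hl
    · rw [hB k i hl.le, hA i k hl, if_pos (Fin.lt_def.1 hl)]
      linear_combination (lm - lp) * h4
    · rw [hA k i hl, hB i k hl.le, if_neg (not_lt.2 (Fin.lt_def.1 hl).le)]
      linear_combination (lm - lp) * h4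

lemma nec (hpN : p ≤ N) (hp : 0 < p) (lp lm : ℝ) (hle : lm ≠ lp)
    (d : Fin p × Fin N → ℝ)
    (hA : (p * p - p : ℝ) / 2 ≤ ({i | d i = lp}.ncard : ℝ))
    (hB : (p * p + p : ℝ) / 2 ≤ ({i | d i = lm}.ncard : ℝ))
    (H : ∀ W ∈ Matrix.unitaryGroup (Fin p × Fin N) ℂ,
        (PT (W * Matrix.diagonal (fun i => (d i : ℂ)) * Wᴴ)).PosSemidef) :
    0 ≤ (lm + lp) - p * (lp - lm) := by
  classical
  let e : Fin p × Fin p ↪ Fin p × Fin N := ⟨fun x => (x.1, Fin.castLE hpN x.2), fun x y h => by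
    simpa [Prod.ext_iff] using h⟩
  let A0 : Finset (Fin p × Fin p) := Finset.univ.filter fun x => x.2 < x.1
  let B0 : Finset (Fin p × Fin p) := Finset.univ.filter fun x => x.1 ≤ x.2
  have cA : (A0.card : ℝ) = (p * p - p) / 2 := by
    have h1 : A0.card = ∑ k : Fin p, k.val := by
      rw [Finset.card_filter, Fintype.sum_prod_type]
      refine Finset.sum_congr rfl fun k _ => ?_
      rw [← Finset.card_filter]
      exact (congrArg Finset.card (by ext; simp)).trans (Fin.card_Iio k)
    have h2 := Finset.sum_range_id_mul_two p
    rw [Finset.sum_range (fun i => i), ← h1] at h2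
    have h3 : (A0.card : ℝ) * 2 = p * (p - 1) := by
      have h4 : ((p - 1 : ℕ) : ℝ) = (p : ℝ) - 1 := Nat.cast_pred hp
      rw [← h4]; exact_mod_cast h2
    linarith
  have cAB : A0.card + B0.card = p * p := by
    have := Finset.card_filter_add_card_filter_not (s := (Finset.univ : Finset (Fin p × Fin p)))
      (fun x => x.2 < x.1)
    simpa [A0, B0] using this
  have cB : (B0.card : ℝ) = (p * p + p) / 2 := by
    have : (A0.card : ℝ) + B0.card = p * p := by exact_mod_cast cAB
    linarith
  obtain ⟨π, hπA, hπB⟩ := exists_perm d lp lm hle (A0.map e) (B0.map e) (by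
      rw [Finset.disjoint_map, Finset.disjoint_left]
      intro x hx hy
      simp only [A0, B0, Finset.mem_filter] at hx hy
      exact absurd hx.2 (not_lt.2 hy.2))
    (by rw [Finset.card_map]; rw [← cA] at hA; exact_mod_cast hA)
    (by rw [Finset.card_map]; rw [← cB] at hB; exact_mod_cast hB)
  have hgA : ∀ k i : Fin p, i < k → d (π (k, Fin.castLE hpN i)) = lp := fun k i h =>
    hπA _ (Finset.mem_map.2 ⟨(k, i), by simp [A0, h], rfl⟩)
  have hgB : ∀ k i : Fin p, k ≤ i → d (π (k, Fin.castLE hpN i)) = lm := fun k i h =>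
    hπB _ (Finset.mem_map.2 ⟨(k, i), by simp [B0, h], rfl⟩)
  set Q := QQ (sw hpN) (cc hpN) (tt hpN) with hQ
  have hQh : Qᴴ = Q := QQ_herm _ _ _ (sw_sw hpN) (tt_sw hpN)
  have hQQ : Q * Q = 1 := QQ_sq _ _ _ (sw_sw hpN) (tt_sw hpN) (cc_tt1 hpN) (cc_tt2 hpN)
  have hW : Q.submatrix id π.symm ∈ Matrix.unitaryGroup (Fin p × Fin N) ℂ := by
    rw [Matrix.mem_unitaryGroup_iff, Matrix.star_eq_conjTranspose, Matrix.conjTranspose_submatrix,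
      Matrix.submatrix_mul_equiv, hQh, hQQ]
    simp
  have h := H _ hW
  have hD : Matrix.diagonal (fun i => (d i : ℂ)) =
      (Matrix.diagonal (fun i => (d (π i) : ℂ))).submatrix π.symm π.symm := by
    rw [Matrix.submatrix_diagonal_equiv]
    congr 1; ext i; simp
  rw [hD, Matrix.conjTranspose_submatrix, Matrix.submatrix_mul_equiv, Matrix.submatrix_mul_equiv,
    hQh, Matrix.submatrix_id_id] at h
  have h' := (h.submatrix (fun i : Fin p => (i, Fin.castLE hpN i))).dotProduct_mulVec_nonneg
    (fun _ => (1 : ℂ))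
  have hv : ∀ i k : Fin p, (PT (Q * Matrix.diagonal (fun i => (d (π i) : ℂ)) * Q)).submatrix
      (fun i : Fin p => (i, Fin.castLE hpN i)) (fun i : Fin p => (i, Fin.castLE hpN i)) i k =
      (((lm - lp) / 2 + if k = i then (lm + lp) / 2 else 0 : ℝ) : ℂ) := fun i k =>
    conj_val hpN (fun x => d (π x)) lp lm hgA hgB k i
  simp only [dotProduct, Matrix.mulVec, hv, Pi.star_apply, star_one, one_mul, mul_one] at h'
  rw [← Complex.ofReal_zero] at h'
  have h'' : (0 : ℝ) ≤ ∑ i : Fin p, ∑ k : Fin p, ((lm - lp) / 2 + if k = i then (lm + lp) / 2 else 0) := by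
    exact_mod_cast h'
  simp [Finset.sum_add_distrib] at h''
  have hp' : (0 : ℝ) < p := by exact_mod_cast hp
  have : 0 ≤ (p : ℝ) * ((lm + lp) - p * (lp - lm)) := by nlinarith
  exact nonneg_of_mul_nonneg_right this hp' 
end

theorem stmt7 (m n : ℕ) (hmn : m < n) (lp lm : ℝ) (hle : lm ≤ lp) (h0 : 0 ≤ lm)
    (τ : Matrix (Fin (2 ^ m) × Fin (2 ^ n)) (Fin (2 ^ m) × Fin (2 ^ n)) ℂ)
    (hτ : τ.PosSemidef) (htr : τ.trace = 1)
    (hmax : ∀ i, hτ.1.eigenvalues i ≤ lp) (hmaxex : ∃ i, hτ.1.eigenvalues i = lp)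
    (hmin : ∀ i, lm ≤ hτ.1.eigenvalues i) (hminex : ∃ i, hτ.1.eigenvalues i = lm)
    (hmultp : (2 : ℝ) ^ (2 * (m : ℤ) - 1) - (2 : ℝ) ^ ((m : ℤ) - 1)
      ≤ ({i | hτ.1.eigenvalues i = lp}.ncard : ℝ))
    (hmultm : (2 : ℝ) ^ (2 * (m : ℤ) - 1) + (2 : ℝ) ^ ((m : ℤ) - 1)
      ≤ ({i | hτ.1.eigenvalues i = lm}.ncard : ℝ)) :
    (∀ U ∈ Matrix.unitaryGroup (Fin (2 ^ m) × Fin (2 ^ n)) ℂ,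
        (PT (U * τ * Uᴴ)).PosSemidef) ↔
      0 ≤ (1 / 2 : ℝ) * (lp + lm) - (2 : ℝ) ^ ((m : ℤ) - 1) * (lp - lm) := by
  have e1 : (2 : ℝ) ^ ((m : ℤ) - 1) = 2 ^ m / 2 := by
    rw [zpow_sub₀ (by norm_num)]; simp
  have e2 : (2 : ℝ) ^ (2 * (m : ℤ) - 1) = 2 ^ m * 2 ^ m / 2 := by
    rw [zpow_sub₀ (by norm_num), two_mul, zpow_add₀ (by norm_num)]; simp
  rw [e1] at hmultp hmultm ⊢
  rw [e2] at hmultp hmultm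
  have hspec := hτ.1.spectral_theorem
  rw [Unitary.conjStarAlgAut_apply] at hspec
  set V : Matrix (Fin (2 ^ m) × Fin (2 ^ n)) (Fin (2 ^ m) × Fin (2 ^ n)) ℂ :=
    hτ.1.eigenvectorUnitary.1 with hV
  have hVm : V ∈ Matrix.unitaryGroup (Fin (2 ^ m) × Fin (2 ^ n)) ℂ := hτ.1.eigenvectorUnitary.2
  generalize hτ.1.eigenvalues = d at *
  have hspec' : τ = V * Matrix.diagonal (fun i => (d i : ℂ)) * Vᴴ := hspec
  constructor
  · intro H
    by_cases hne : lm = lp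
    · subst hne; linarith
    · have := nec (p := 2 ^ m) (N := 2 ^ n) (Nat.pow_le_pow_right (by norm_num) hmn.le)
        (by positivity) lp lm hne d (by push_cast; linarith) (by push_cast; linarith) (by
          intro W hW
          have h1 := H (W * Vᴴ) (mul_mem hW (Unitary.star_mem hVm))
          have hVV : Vᴴ * V = 1 := Matrix.mem_unitaryGroup_iff'.1 hVm
          have h2 : W * Vᴴ * τ * (W * Vᴴ)ᴴ = W * Matrix.diagonal (fun i => (d i : ℂ)) * Wᴴ := by
            rw [hspec', Matrix.conjTranspose_mul, Matrix.conjTranspose_conjTranspose]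
            calc _ = W * (Vᴴ * V) * Matrix.diagonal (fun i => (d i : ℂ)) * (Vᴴ * V) * Wᴴ := by
                  simp only [Matrix.mul_assoc]
              _ = _ := by rw [hVV]; simp
          rwa [h2] at h1)
      push_cast at this
      linarith
  · intro H U hU
    have hWm : U * V ∈ Matrix.unitaryGroup (Fin (2 ^ m) × Fin (2 ^ n)) ℂ := mul_mem hU hVm
    have hσ : U * τ * Uᴴ = (U * V) * Matrix.diagonal (fun i => (d i : ℂ)) * (U * V)ᴴ := by
      rw [hspec', Matrix.conjTranspose_mul]; simp only [Matrix.mul_assoc]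
    rw [hσ]
    generalize U * V = W at *
    have hWW : W * Wᴴ = 1 := Matrix.mem_unitaryGroup_iff.1 hWm
    have hc : ∀ r : ℝ, (r • 1 : Matrix (Fin (2 ^ m) × Fin (2 ^ n)) (Fin (2 ^ m) × Fin (2 ^ n)) ℂ)
        = W * Matrix.diagonal (fun _ => (r : ℂ)) * Wᴴ := by
      intro r
      have : Matrix.diagonal (fun _ => (r : ℂ)) =
        (r • 1 : Matrix (Fin (2 ^ m) × Fin (2 ^ n)) (Fin (2 ^ m) × Fin (2 ^ n)) ℂ) := by
        ext i j
        simp [Matrix.diagonal_apply, Matrix.one_apply]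
      rw [this, Matrix.mul_smul, Matrix.smul_mul, Matrix.mul_one, hWW]
    apply PT_psd (lp := lp) (lm := lm)
    · rw [hc, ← Matrix.sub_mul, ← Matrix.mul_sub, Matrix.diagonal_sub]
      refine (Matrix.posSemidef_diagonal_iff.2 fun i => ?_).mul_mul_conjTranspose_same _
      rw [← Complex.ofReal_sub]
      exact_mod_cast sub_nonneg.2 (hmin i)
    · rw [hc, ← Matrix.sub_mul, ← Matrix.mul_sub, Matrix.diagonal_sub]
      refine (Matrix.posSemidef_diagonal_iff.2 fun i => ?_).mul_mul_conjTranspose_same _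
      rw [← Complex.ofReal_sub]
      exact_mod_cast sub_nonneg.2 (hmax i)
    · simp only [Fintype.card_fin]
      push_cast
      linarith
end

section
/- Let n, k be natural numbers with 1 ≤ k < (n+1)/2, and let ρ be a positive semidefinite trace-one matrix on ℂ^{2^k} ⊗ ℂ^{2^{n−k+1}} having exactly two eigenvalues λ₁ > λ₂ ≥ 0, each with multiplicity 2^n. Then ρ is PPT from spectrum for the 2^k : 2^{n−k+1} bipartition (i.e. for every unitary U on ℂ^{2^{n+1}}, the partial transpose on the first factor of U ρ U† is positive semidefinite) if and only if ½(λ₁ + λ₂) − 2^{k−1}(λ₁ − λ₂) ≥ 0. -/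
open Matrix
open scoped ComplexOrder

lemma aux_herm_eq {ι : Type*} [Fintype ι] [DecidableEq ι] {M : Matrix ι ι ℂ} (hM : M.IsHermitian) :
    M = (hM.eigenvectorUnitary : Matrix ι ι ℂ) * diagonal (fun i => (hM.eigenvalues i : ℂ)) *
      (hM.eigenvectorUnitary : Matrix ι ι ℂ)ᴴ := by
  have := hM.spectral_theorem
  rw [Unitary.conjStarAlgAut_apply] at this
  exact this

lemma aux_unit {ι : Type*} [Fintype ι] [DecidableEq ι] (V : Matrix.unitaryGroup ι ℂ) :
    (V : Matrix ι ι ℂ)ᴴ * V = 1 ∧ (V : Matrix ι ι ℂ) * (V : Matrix ι ι ℂ)ᴴ = 1 :=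
  ⟨Matrix.mem_unitaryGroup_iff'.1 V.2, Matrix.mem_unitaryGroup_iff.1 V.2⟩

lemma aux_conj {ι : Type*} [Fintype ι] [DecidableEq ι] {R M : Matrix ι ι ℂ} (hR : R.IsHermitian)
    (hM : M.IsHermitian) (h : R.charpoly = M.charpoly) :
    ∃ U ∈ Matrix.unitaryGroup ι ℂ, U * R * Uᴴ = M := by
  have he := (hR.eigenvalues_eq_eigenvalues_iff hM).2 h
  refine ⟨(hM.eigenvectorUnitary * hR.eigenvectorUnitary⁻¹ : Matrix.unitaryGroup ι ℂ),
    Subtype.property _, ?_⟩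
  have h1 := aux_herm_eq hR
  have h2 := aux_herm_eq hM
  have hV := aux_unit hR.eigenvectorUnitary
  rw [← he] at h2
  have hc : ((hM.eigenvectorUnitary * hR.eigenvectorUnitary⁻¹ : Matrix.unitaryGroup ι ℂ) :
      Matrix ι ι ℂ) = (hM.eigenvectorUnitary : Matrix ι ι ℂ) *
      (hR.eigenvectorUnitary : Matrix ι ι ℂ)ᴴ := rfl
  rw [hc]
  generalize (hM.eigenvectorUnitary : Matrix ι ι ℂ) = W at *
  generalize (hR.eigenvectorUnitary : Matrix ι ι ℂ) = V at *
  generalize diagonal (fun i => (hR.eigenvalues i : ℂ)) = D at *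
  rw [h2, h1, conjTranspose_mul, conjTranspose_conjTranspose]
  calc W * Vᴴ * (V * D * Vᴴ) * (V * Wᴴ) = W * (Vᴴ * V) * D * (Vᴴ * V) * Wᴴ := by
        simp only [Matrix.mul_assoc]
    _ = _ := by simp [hV.1]

lemma aux_eig {ι : Type*} [Fintype ι] [DecidableEq ι] {M : Matrix ι ι ℂ} (hM : M.IsHermitian)
    (l1 l2 : ℝ) (h : M * M = ((l1 + l2 : ℝ) : ℂ) • M - ((l1 * l2 : ℝ) : ℂ) • 1) (i : ι) :
    hM.eigenvalues i = l1 ∨ hM.eigenvalues i = l2 := by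
  have h1 := aux_herm_eq hM
  have hV := aux_unit hM.eigenvectorUnitary
  generalize (hM.eigenvectorUnitary : Matrix ι ι ℂ) = V at *
  set D := diagonal (fun i => (hM.eigenvalues i : ℂ)) with hD
  have hD1 : Vᴴ * M * V = D := by
    rw [h1]
    calc Vᴴ * (V * D * Vᴴ) * V = (Vᴴ * V) * D * (Vᴴ * V) := by simp only [Matrix.mul_assoc]
      _ = _ := by simp [hV.1]
  have hD2 : Vᴴ * (M * M) * V = D * D := by
    rw [← hD1]
    calc Vᴴ * (M * M) * V = Vᴴ * M * 1 * M * V := by simp only [Matrix.mul_assoc, Matrix.one_mul]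
      _ = _ := by rw [← hV.2]; simp only [Matrix.mul_assoc]
  have hD3 : D * D = ((l1 + l2 : ℝ) : ℂ) • D - ((l1 * l2 : ℝ) : ℂ) • 1 := by
    rw [← hD2, h, Matrix.mul_sub, Matrix.sub_mul, Matrix.mul_smul, Matrix.smul_mul, hD1]
    simp [hV.1]
  have h4 := congrFun (congrFun hD3 i) i
  simp only [hD, diagonal_mul_diagonal, diagonal_apply_eq, Matrix.sub_apply, Matrix.smul_apply,
    Matrix.one_apply_eq, smul_eq_mul, mul_one] at h4
  have h5 : hM.eigenvalues i * hM.eigenvalues i = (l1 + l2) * hM.eigenvalues i - l1 * l2 := by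
    exact_mod_cast h4
  have h6 : (hM.eigenvalues i - l1) * (hM.eigenvalues i - l2) = 0 := by linarith
  rcases mul_eq_zero.1 h6 with h7 | h7
  · left; linarith
  · right; linarith

lemma aux_prod {ι α : Type*} [Fintype ι] [CommMonoid α] (l1 l2 : ℝ) (hne : l1 ≠ l2)
    (f g : ι → ℝ) (hf : ∀ i, f i = l1 ∨ f i = l2) (hg : ∀ i, g i = l1 ∨ g i = l2)
    (hs : ∑ i, f i = ∑ i, g i) (F : ℝ → α) : ∏ i, F (f i) = ∏ i, F (g i) := by
  classical
  have key : ∀ f : ι → ℝ, (∀ i, f i = l1 ∨ f i = l2) → ∃ a b : ℕ, a + b = Fintype.card ι ∧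
      ∑ i, f i = a * l1 + b * l2 ∧ ∏ i, F (f i) = F l1 ^ a * F l2 ^ b := by
    intro f hf
    have hfe : ∀ i, f i = if f i = l1 then l1 else l2 := by
      intro i
      split_ifs with h
      · exact h
      · exact (hf i).resolve_left h
    refine ⟨(Finset.univ.filter fun i => f i = l1).card,
      (Finset.univ.filter fun i => ¬ f i = l1).card, ?_, ?_, ?_⟩
    · exact Finset.card_filter_add_card_filter_not _
    · rw [Finset.sum_congr rfl (fun i _ => hfe i), Finset.sum_ite]; simp
    · rw [Finset.prod_congr rfl (fun i _ => congrArg F (hfe i))]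
      simp_rw [apply_ite F]
      rw [Finset.prod_ite]; simp
  obtain ⟨a, b, h1, h2, h3⟩ := key f hf
  obtain ⟨a', b', h1', h2', h3'⟩ := key g hg
  have hb : (a : ℝ) + b = a' + b' := by exact_mod_cast h1.trans h1'.symm
  have h4 : ((a : ℝ) - a') * (l1 - l2) = 0 := by
    have : (b : ℝ) = a' + b' - a := by linarith
    rw [h2, h2', this] at hs
    linarith
  have h5 : a = a' := by
    rcases mul_eq_zero.1 h4 with h | h
    · have : (a : ℝ) = a' := by linarith
      exact_mod_cast this
    · exact absurd (by linarith) hne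
  have h6 : b = b' := by omega
  rw [h3, h3', h5, h6]

/-- A Hermitian matrix with two eigenvalues is an affine function of a Hermitian involution. -/
lemma aux_invol {ι : Type*} [Fintype ι] [DecidableEq ι] {R : Matrix ι ι ℂ} (hR : R.IsHermitian)
    (l1 l2 : ℝ) (h : ∀ i, hR.eigenvalues i = l1 ∨ hR.eigenvalues i = l2) :
    ∃ S : Matrix ι ι ℂ, Sᴴ = S ∧ S * S = 1 ∧
      R = (((l1 + l2) / 2 : ℝ) : ℂ) • 1 + (((l1 - l2) / 2 : ℝ) : ℂ) • S := by
  classical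
  have h1 := aux_herm_eq hR
  have hV := aux_unit hR.eigenvectorUnitary
  generalize (hR.eigenvectorUnitary : Matrix ι ι ℂ) = V at *
  set E : Matrix ι ι ℂ := diagonal (fun i => if hR.eigenvalues i = l1 then 1 else -1) with hE
  have hEE : E * E = 1 := by
    rw [hE, diagonal_mul_diagonal, ← diagonal_one]
    congr 1; ext i; split_ifs <;> simp
  have hEh : Eᴴ = E := by
    rw [hE, diagonal_conjTranspose]
    congr 1; ext i; simp only [Pi.star_apply]; split_ifs <;> simp
  have hD : diagonal (fun i => (hR.eigenvalues i : ℂ)) =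
      (((l1 + l2) / 2 : ℝ) : ℂ) • 1 + (((l1 - l2) / 2 : ℝ) : ℂ) • E := by
    rw [hE, ← diagonal_one, ← diagonal_smul, ← diagonal_smul, diagonal_add]
    congr 1; ext i
    simp only [Pi.smul_apply, smul_eq_mul]
    split_ifs with hi
    · rw [hi]; push_cast; ring
    · rw [(h i).resolve_left hi]; push_cast; ring
  refine ⟨V * E * Vᴴ, ?_, ?_, ?_⟩
  · simp only [conjTranspose_mul, conjTranspose_conjTranspose, hEh, Matrix.mul_assoc]
  · calc V * E * Vᴴ * (V * E * Vᴴ) = V * E * (Vᴴ * V) * E * Vᴴ := by simp only [Matrix.mul_assoc]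
      _ = V * (E * E) * Vᴴ := by rw [hV.1, Matrix.mul_one]; simp only [Matrix.mul_assoc]
      _ = 1 := by rw [hEE, Matrix.mul_one, hV.2]
  · conv_lhs => rw [h1]
    rw [hD, Matrix.mul_add, Matrix.add_mul]
    simp [hV.2]

lemma aux_PT_herm {A B : Type*} {M : Matrix (A × B) (A × B) ℂ} (h : Mᴴ = M) : (PT M)ᴴ = PT M := by
  ext p q
  simp only [conjTranspose_apply, PT, of_apply]
  exact congrFun (congrFun h _) _

/-- Auxiliary vector. -/
def auxU {A B : Type*} [DecidableEq A] (x : A × B → ℂ) (a c : A) : A × B → ℂ :=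
  fun i => if i.1 = c then x (a, i.2) else 0

lemma aux_quad {A B : Type*} [Fintype A] [Fintype B] [DecidableEq A] [DecidableEq B]
    (S : Matrix (A × B) (A × B) ℂ) (x : A × B → ℂ) :
    star x ⬝ᵥ (PT S *ᵥ x) = ∑ a, ∑ c, star (auxU x a c) ⬝ᵥ (S *ᵥ auxU x c a) := by
  simp only [dotProduct, mulVec, PT, of_apply, auxU, Pi.star_apply, Fintype.sum_prod_type]
  refine Finset.sum_congr rfl fun a _ => ?_
  have : ∀ c : A, (∑ c' : A, ∑ b : B, star (if c' = c then x (a, b) else 0) *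
      ∑ a' : A, ∑ e : B, S (c', b) (a', e) * (if a' = a then x (c, e) else 0)) =
      ∑ b : B, star (x (a, b)) * ∑ e : B, S (c, b) (a, e) * x (c, e) := by
    intro c
    rw [Finset.sum_eq_single c]
    · refine Finset.sum_congr rfl fun b _ => ?_
      rw [if_pos rfl]
      congr 1
      rw [Finset.sum_eq_single a]
      · simp
      · intro a' _ ha; simp [ha]
      · simp
    · intro c' _ hc; simp [hc]
    · simp
  rw [Finset.sum_congr rfl fun c _ => this c, Finset.sum_comm]
  simp only [Finset.mul_sum]

lemma aux_norm {A B : Type*} [Fintype A] [Fintype B] [DecidableEq A] [DecidableEq B]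
    (x : A × B → ℂ) :
    ∑ a, ∑ c, star (auxU x a c) ⬝ᵥ auxU x a c = (Fintype.card A : ℂ) * (star x ⬝ᵥ x) := by
  have : ∀ a c, star (auxU x a c) ⬝ᵥ auxU x a c = ∑ b, star (x (a, b)) * x (a, b) := by
    intro a c
    simp only [dotProduct, auxU, Pi.star_apply, Fintype.sum_prod_type]
    rw [Finset.sum_eq_single c]
    · simp
    · intro c' _ hc; simp [hc]
    · simp
  simp only [this, Finset.sum_const, Finset.card_univ, nsmul_eq_mul, ← Finset.mul_sum]
  simp [dotProduct, Fintype.sum_prod_type]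

lemma aux_bound {A B : Type*} [Fintype A] [Fintype B] [DecidableEq A] [DecidableEq B]
    (S : Matrix (A × B) (A × B) ℂ) (hS : Sᴴ = S) (hSS : S * S = 1) (x : A × B → ℂ) :
    0 ≤ (Fintype.card A : ℂ) * (star x ⬝ᵥ x) + star x ⬝ᵥ (PT S *ᵥ x) := by
  have hw : ∀ u v : A × B → ℂ, 0 ≤ star u ⬝ᵥ u + star v ⬝ᵥ v + star u ⬝ᵥ (S *ᵥ v) +
      star v ⬝ᵥ (S *ᵥ u) := by
    intro u v
    have h0 : 0 ≤ star (u + S *ᵥ v) ⬝ᵥ (u + S *ᵥ v) := dotProduct_star_self_nonneg _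
    have h1 : star (S *ᵥ v) = star v ᵥ* S := by rw [star_mulVec, hS]
    rw [star_add, h1, add_dotProduct, dotProduct_add, dotProduct_add, ← dotProduct_mulVec,
      ← dotProduct_mulVec, mulVec_mulVec, hSS, one_mulVec] at h0
    convert h0 using 1
    ring
  have h1 : 0 ≤ ∑ a, ∑ c, (star (auxU x a c) ⬝ᵥ auxU x a c + star (auxU x c a) ⬝ᵥ auxU x c a +
      star (auxU x a c) ⬝ᵥ (S *ᵥ auxU x c a) + star (auxU x c a) ⬝ᵥ (S *ᵥ auxU x a c)) :=
    Finset.sum_nonneg fun a _ => Finset.sum_nonneg fun c _ => hw _ _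
  simp only [Finset.sum_add_distrib] at h1
  rw [Finset.sum_comm (f := fun a c => star (auxU x c a) ⬝ᵥ auxU x c a),
    Finset.sum_comm (f := fun a c => star (auxU x c a) ⬝ᵥ (S *ᵥ auxU x a c)),
    aux_norm, ← aux_quad] at h1
  have h2 : (0 : ℂ) ≤ (1 / 2 : ℝ) := by exact_mod_cast (by norm_num : (0 : ℝ) ≤ 1 / 2)
  have h3 := mul_nonneg h2 h1
  convert h3 using 1
  push_cast
  ring

lemma aux_PT_affine {A B : Type*} [DecidableEq A] [DecidableEq B] (s t : ℂ)
    (S : Matrix (A × B) (A × B) ℂ) : PT (s • 1 + t • S) = s • 1 + t • PT S := by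
  ext ⟨a, b⟩ ⟨c, e⟩
  simp only [PT, of_apply, Matrix.add_apply, Matrix.smul_apply, Matrix.one_apply, Prod.mk.injEq]
  congr 2
  simp only [eq_comm (a := c) (b := a)]

lemma aux_psd {A B : Type*} [Fintype A] [Fintype B] [DecidableEq A] [DecidableEq B]
    (S : Matrix (A × B) (A × B) ℂ) (hS : Sᴴ = S) (hSS : S * S = 1) (s t : ℝ) (ht : 0 ≤ t)
    (hst : Fintype.card A * t ≤ s) : (PT ((s : ℂ) • 1 + (t : ℂ) • S)).PosSemidef := by
  refine PosSemidef.of_dotProduct_mulVec_nonneg ?_ ?_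
  · apply aux_PT_herm
    simp [hS]
  · intro x
    rw [aux_PT_affine, add_mulVec, smul_mulVec, smul_mulVec, one_mulVec, dotProduct_add,
      dotProduct_smul, dotProduct_smul]
    have h1 : (0 : ℂ) ≤ (t : ℂ) := by exact_mod_cast ht
    have h2 : (0 : ℂ) ≤ ((s - Fintype.card A * t : ℝ) : ℂ) := by
      exact_mod_cast sub_nonneg.2 hst
    have h3 := add_nonneg (mul_nonneg h2 (dotProduct_star_self_nonneg x))
      (mul_nonneg h1 (aux_bound S hS hSS x))
    convert h3 using 1
    simp only [smul_eq_mul]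
    push_cast
    ring

/-- Signed block swap. -/
def auxS {A B C : Type*} [DecidableEq A] [DecidableEq C] (e : B ≃ A × (Bool × C)) :
    Matrix (A × B) (A × B) ℂ :=
  Matrix.of fun p q => if p.1 = (e q.2).1 ∧ (e p.2).1 = q.1 ∧ (e p.2).2 = (e q.2).2 then
    (if (e p.2).2.1 then -1 else 1) else 0

lemma auxS_herm {A B C : Type*} [DecidableEq A] [DecidableEq C] (e : B ≃ A × (Bool × C)) :
    (auxS e)ᴴ = auxS e := by
  ext p q
  simp only [auxS, conjTranspose_apply, of_apply]
  by_cases h : p.1 = (e q.2).1 ∧ (e p.2).1 = q.1 ∧ (e p.2).2 = (e q.2).2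
  · obtain ⟨h1, h2, h3⟩ := h
    have h4 : q.1 = (e p.2).1 ∧ (e q.2).1 = p.1 ∧ (e q.2).2 = (e p.2).2 :=
      ⟨h2.symm, h1.symm, h3.symm⟩
    have h5 : p.1 = (e q.2).1 ∧ (e p.2).1 = q.1 ∧ (e p.2).2 = (e q.2).2 := ⟨h1, h2, h3⟩
    simp only [if_pos h4, if_pos h5]
    rw [h3]
    split_ifs <;> simp
  · rw [if_neg h, if_neg, star_zero]
    rintro ⟨h1, h2, h3⟩
    exact h ⟨h2.symm, h1.symm, h3.symm⟩

lemma auxS_sq {A B C : Type*} [Fintype A] [Fintype B] [DecidableEq B] [DecidableEq A]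
    [DecidableEq C] (e : B ≃ A × (Bool × C)) : auxS e * auxS e = 1 := by
  ext p q
  rw [Matrix.mul_apply, Finset.sum_eq_single ((e p.2).1, e.symm (p.1, (e p.2).2))]
  · simp only [auxS, of_apply, Equiv.apply_symm_apply, true_and, and_true, if_true, one_apply]
    by_cases h : p = q
    · subst h
      simp only [and_self, if_true]
      split_ifs <;> simp
    · have h4 : ¬ ((e p.2).1 = (e q.2).1 ∧ p.1 = q.1 ∧ (e p.2).2 = (e q.2).2) := by
        rintro ⟨h1, h2, h3⟩
        exact h (Prod.ext h2 (e.injective (Prod.ext h1 h3)))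
      rw [if_neg h, if_neg h4, mul_zero]
  · intro r _ hr
    simp only [auxS, of_apply]
    rw [if_neg, zero_mul]
    rintro ⟨h1, h2, h3⟩
    apply hr
    refine Prod.ext h2.symm ?_
    rw [Equiv.eq_symm_apply]
    exact Prod.ext h1.symm h3.symm
  · simp

lemma auxS_trace {A B C : Type*} [Fintype A] [Fintype B] [Fintype C] [DecidableEq B]
    [DecidableEq A] [DecidableEq C] (e : B ≃ A × (Bool × C)) : (auxS e).trace = 0 := by
  simp only [Matrix.trace, diag_apply, auxS, of_apply, Fintype.sum_prod_type, and_true]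
  refine Finset.sum_eq_zero fun a _ => ?_
  rw [← e.symm.sum_comp]
  simp only [Equiv.apply_symm_apply, Fintype.sum_prod_type]
  refine Finset.sum_eq_zero fun b _ => ?_
  simp only [Fintype.sum_bool, ← Finset.sum_add_distrib]
  refine Finset.sum_eq_zero fun c _ => ?_
  by_cases h : a = b
  · simp [h]
  · simp [h]

lemma auxS_val {A B C : Type*} [Fintype A] [Fintype B] [DecidableEq B]
    [DecidableEq A] [DecidableEq C] (e : B ≃ A × (Bool × C)) (c : C) (s t : ℂ)
    (x : A × B → ℂ) (hx : x = fun p => if p.2 = e.symm (p.1, (true, c)) then 1 else 0) :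
    star x ⬝ᵥ (PT (s • 1 + t • auxS e) *ᵥ x) =
      Fintype.card A * s - Fintype.card A * (Fintype.card A * t) := by
  have h1 : ∀ f : A × B → ℂ, ∑ p, x p * f p = ∑ a, f (a, e.symm (a, (true, c))) := by
    intro f
    rw [hx, Fintype.sum_prod_type]
    simp
  have h1' : ∀ f : A × B → ℂ, ∑ p, f p * x p = ∑ a, f (a, e.symm (a, (true, c))) := by
    intro f
    rw [← h1]; simp only [mul_comm]
  have h2 : star x = x := by
    rw [hx]; ext p; simp only [Pi.star_apply]; split_ifs <;> simp
  rw [aux_PT_affine, h2]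
  simp only [dotProduct, mulVec, h1, h1']
  simp only [Matrix.add_apply, Matrix.smul_apply, one_apply, PT, of_apply, auxS,
    Equiv.apply_symm_apply, smul_eq_mul, Finset.sum_add_distrib, Prod.mk.injEq,
    EmbeddingLike.apply_eq_iff_eq, and_true, and_self, if_true, mul_ite, mul_one, mul_zero,
    Finset.sum_ite_eq, Finset.mem_univ, Finset.sum_const, Finset.card_univ, nsmul_eq_mul]
  ring

/-- let `1 ≤ k < (n+1)/2` and let `ρ` be a PSD trace-one matrix on
`ℂ^{2^k} ⊗ ℂ^{2^{n−k+1}}` having exactly the two eigenvalues `λ₁ > λ₂ ≥ 0`, each with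
multiplicity `2^n`. Then `ρ` is PPT from spectrum for the `2^k : 2^{n−k+1}`
bipartition iff `½(λ₁ + λ₂) − 2^{k−1}(λ₁ − λ₂) ≥ 0`. -/
theorem stmt8 (n k : ℕ) (hk1 : 1 ≤ k) (hk2 : 2 * k < n + 1)
    (l1 l2 : ℝ) (hlt : l2 < l1) (h0 : 0 ≤ l2)
    (ρ : Matrix (Fin (2 ^ k) × Fin (2 ^ (n - k + 1)))
      (Fin (2 ^ k) × Fin (2 ^ (n - k + 1))) ℂ)
    (hρ : ρ.PosSemidef) (htr : ρ.trace = 1)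
    (heig : ∀ i, hρ.1.eigenvalues i = l1 ∨ hρ.1.eigenvalues i = l2)
    (hmult1 : {i | hρ.1.eigenvalues i = l1}.ncard = 2 ^ n)
    (hmult2 : {i | hρ.1.eigenvalues i = l2}.ncard = 2 ^ n) :
    (∀ U ∈ Matrix.unitaryGroup (Fin (2 ^ k) × Fin (2 ^ (n - k + 1))) ℂ,
        (PT (U * ρ * Uᴴ)).PosSemidef) ↔
      0 ≤ (1 / 2 : ℝ) * (l1 + l2) - (2 : ℝ) ^ ((k : ℤ) - 1) * (l1 - l2) := by
  have hpow : (2 : ℝ) ^ ((k : ℤ) - 1) = 2 ^ k / 2 := by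
    rw [zpow_sub₀ (by norm_num), zpow_natCast, zpow_one]
  rw [hpow]
  constructor
  · intro H
    have hcard : Fintype.card (Fin (2 ^ (n - k + 1))) =
        Fintype.card (Fin (2 ^ k) × (Bool × Fin (2 ^ (n - 2 * k)))) := by
      simp only [Fintype.card_prod, Fintype.card_fin, Fintype.card_bool]
      rw [← pow_succ', ← pow_add]
      congr 1
      omega
    let e := Fintype.equivOfCardEq hcard
    set s : ℂ := (((l1 + l2) / 2 : ℝ) : ℂ) with hs
    set t : ℂ := (((l1 - l2) / 2 : ℝ) : ℂ) with ht
    have hM : (s • 1 + t • auxS e).IsHermitian := by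
      unfold Matrix.IsHermitian
      rw [conjTranspose_add, conjTranspose_smul, conjTranspose_smul, auxS_herm]
      simp [hs, ht]
    have hMM : (s • 1 + t • auxS e) * (s • 1 + t • auxS e) =
        ((l1 + l2 : ℝ) : ℂ) • (s • 1 + t • auxS e) - ((l1 * l2 : ℝ) : ℂ) • 1 := by
      have hsq := auxS_sq e
      rw [Matrix.add_mul, Matrix.mul_add, Matrix.mul_add]
      simp only [Matrix.smul_mul, Matrix.mul_smul, Matrix.one_mul, Matrix.mul_one, hsq]
      rw [hs, ht]
      push_cast
      module
    have hE := aux_eig hM l1 l2 hMM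
    have hsum1 : ∑ i, hρ.1.eigenvalues i = 2 ^ n * l1 + 2 ^ n * l2 := by
      classical
      have hfe : ∀ i, hρ.1.eigenvalues i = (if hρ.1.eigenvalues i = l1 then l1 else 0) +
          (if hρ.1.eigenvalues i = l2 then l2 else 0) := by
        intro i
        rcases heig i with h | h
        · rw [h]; simp [hlt.ne']
        · rw [h]; simp [hlt.ne]
      rw [Finset.sum_congr rfl (fun i _ => hfe i), Finset.sum_add_distrib, ← Finset.sum_filter,
        ← Finset.sum_filter, Finset.sum_const, Finset.sum_const]
      rw [Set.ncard_eq_toFinset_card', Set.toFinset_ofPred] at hmult1 hmult2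
      rw [hmult1, hmult2]
      simp
    have hsum2 : ∑ i, hM.eigenvalues i = 2 ^ n * l1 + 2 ^ n * l2 := by
      have h := hM.trace_eq_sum_eigenvalues
      rw [trace_add, trace_smul, trace_smul, auxS_trace, trace_one] at h
      have hc : ((Fintype.card (Fin (2 ^ k) × Fin (2 ^ (n - k + 1))) : ℕ) : ℂ) = 2 ^ n * 2 := by
        simp only [Fintype.card_prod, Fintype.card_fin]
        rw [← pow_add, ← pow_succ]
        push_cast
        congr 1
        omega
      rw [hc] at h
      have h' : ((∑ i, hM.eigenvalues i : ℝ) : ℂ) = ((2 ^ n * l1 + 2 ^ n * l2 : ℝ) : ℂ) := by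
        push_cast
        refine h.symm.trans ?_
        simp only [smul_eq_mul, hs]
        push_cast
        ring
      exact_mod_cast h'
    have hchar : ρ.charpoly = (s • 1 + t • auxS e).charpoly := by
      rw [hρ.1.charpoly_eq, hM.charpoly_eq]
      exact aux_prod l1 l2 hlt.ne' _ _ heig hE (hsum1.trans hsum2.symm)
        (fun y => Polynomial.X - Polynomial.C (y : ℂ))
    obtain ⟨U, hU, hUe⟩ := aux_conj hρ.1 hM hchar
    have hpsd := H U hU
    rw [hUe] at hpsd
    have hq := (hpsd.dotProduct_mulVec_nonneg _).trans_eq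
      (auxS_val e (⟨0, by positivity⟩) s t _ rfl)
    rw [hs, ht, Fintype.card_fin] at hq
    have hq' : (0 : ℝ) ≤ (2 ^ k : ℕ) * ((l1 + l2) / 2) -
        (2 ^ k : ℕ) * ((2 ^ k : ℕ) * ((l1 - l2) / 2)) := by exact_mod_cast hq
    push_cast at hq'
    have hp : (0 : ℝ) < 2 ^ k := by positivity
    have hq2 : (0 : ℝ) ≤ 2 ^ k * ((1 / 2 : ℝ) * (l1 + l2) - 2 ^ k / 2 * (l1 - l2)) := by
      refine hq'.trans_eq ?_
      ring
    exact nonneg_of_mul_nonneg_right hq2 hp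
  · intro H U hU
    obtain ⟨S, hS, hSS, hR⟩ := aux_invol hρ.1 l1 l2 heig
    have hV := aux_unit ⟨U, hU⟩
    simp only at hV
    have hUR : U * ρ * Uᴴ = (((l1 + l2) / 2 : ℝ) : ℂ) • 1 +
        (((l1 - l2) / 2 : ℝ) : ℂ) • (U * S * Uᴴ) := by
      rw [hR, Matrix.mul_add, Matrix.add_mul]
      simp [hV.2]
    rw [hUR]
    apply aux_psd
    · simp only [conjTranspose_mul, conjTranspose_conjTranspose, hS, Matrix.mul_assoc]
    · calc U * S * Uᴴ * (U * S * Uᴴ) = U * S * (Uᴴ * U) * S * Uᴴ := by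
            simp only [Matrix.mul_assoc]
        _ = U * (S * S) * Uᴴ := by rw [hV.1, Matrix.mul_one]; simp only [Matrix.mul_assoc]
        _ = 1 := by rw [hSS, Matrix.mul_one, hV.2]
    · linarith
    · rw [Fintype.card_fin]
      push_cast
      linarith
end

section
/- Let n, k be natural numbers with 1 ≤ k < (n+1)/2 and let 0 ≤ α ≤ 1. Then the DQC1 state ρ^α_n is PPT from spectrum for the 2^k : 2^{n+1−k} bipartition (i.e. for every unitary U on ℂ^{2^{n+1}}, the partial transpose on the first factor ℂ^{2^k} of U ρ^α_n U† is positive semidefinite) if and only if α ≥ 1 − 1/2^k. -/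
open Matrix Kronecker
open scoped ComplexOrder

/-- The natural identification of the `(n+1)`-qubit index set `Fin 2 × Fin 2ⁿ`
with the `k : (n+1−k)` bipartite index set `Fin 2ᵏ × Fin 2ⁿ⁺¹⁻ᵏ`. -/
def splitIdx (n k : ℕ) (h : k ≤ n + 1) :
    (Fin 2 × Fin (2 ^ n)) ≃ (Fin (2 ^ k) × Fin (2 ^ (n + 1 - k))) :=
  (finProdFinEquiv.trans (finCongr (by ring))).trans
    ((finCongr (show 2 ^ (n + 1) = 2 ^ k * 2 ^ (n + 1 - k) by
        rw [← pow_add]; congr 1; omega)).trans finProdFinEquiv.symm)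

theorem exists_perm_aux {ι : Type*} [Fintype ι] [DecidableEq ι] (f z : ι → ℝ)
    (hf : ∀ i, f i = 1 ∨ f i = -1) (hz : ∀ i, z i = 1 ∨ z i = -1)
    (hs : ∑ i, f i = ∑ i, z i) : ∃ σ : Equiv.Perm ι, ∀ i, f (σ i) = z i := by
  classical
  have key : ∀ g : ι → ℝ, (∀ i, g i = 1 ∨ g i = -1) →
      ∑ i, g i = 2 * (Fintype.card {i // g i = 1} : ℝ) - Fintype.card ι := by
    intro g hg
    have : ∀ i, g i = 2 * (if g i = 1 then 1 else 0) - 1 := by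
      intro i; rcases hg i with h | h <;> rw [h] <;> norm_num
    rw [Finset.sum_congr rfl (fun i _ => this i), Finset.sum_sub_distrib, ← Finset.mul_sum,
      Finset.sum_boole, Fintype.card_subtype]
    simp
  have hc : Fintype.card {i // z i = 1} = Fintype.card {i // f i = 1} := by
    have h1 := key f hf
    have h2 := key z hz
    have : (Fintype.card {i // z i = 1} : ℝ) = Fintype.card {i // f i = 1} := by linarith
    exact_mod_cast this
  let e := Fintype.equivOfCardEq hc
  refine ⟨e.extendSubtype, fun i => ?_⟩
  by_cases h : z i = 1
  · rw [h]; exact e.extendSubtype_mem i h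
  · have := e.extendSubtype_not_mem i h
    rw [(hz i).resolve_left h]
    exact (hf _).resolve_left this

theorem exists_unitary_aux {ι : Type*} [Fintype ι] [DecidableEq ι] (R : Matrix ι ι ℂ)
    (hR : R.IsHermitian) (hRR : R * R = 1) (z : ι → ℝ) (hz : ∀ i, z i = 1 ∨ z i = -1)
    (ht : R.trace = ∑ i, (z i : ℂ)) :
    ∃ U ∈ Matrix.unitaryGroup ι ℂ, U * Matrix.diagonal (fun i => (z i : ℂ)) * Uᴴ = R := by
  set V := hR.eigenvectorUnitary with hV
  have hspec : R = (V : Matrix ι ι ℂ) * Matrix.diagonal (fun i => (hR.eigenvalues i : ℂ)) *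
      (V : Matrix ι ι ℂ)ᴴ := by
    have := hR.spectral_theorem
    rw [Unitary.conjStarAlgAut_apply] at this
    exact this
  have hVV : (V : Matrix ι ι ℂ)ᴴ * (V : Matrix ι ι ℂ) = 1 := Unitary.coe_star_mul_self V
  have hVV' : (V : Matrix ι ι ℂ) * (V : Matrix ι ι ℂ)ᴴ = 1 := Unitary.coe_mul_star_self V
  have hD : (V : Matrix ι ι ℂ)ᴴ * R * V = Matrix.diagonal (fun i => (hR.eigenvalues i : ℂ)) := by
    conv_lhs => rw [hspec]
    simp only [Matrix.mul_assoc, hVV, Matrix.mul_one]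
    rw [← Matrix.mul_assoc, hVV, Matrix.one_mul]
  have hev : ∀ i, hR.eigenvalues i = 1 ∨ hR.eigenvalues i = -1 := by
    intro i
    have h2 : Matrix.diagonal (fun i => (hR.eigenvalues i : ℂ)) *
        Matrix.diagonal (fun i => (hR.eigenvalues i : ℂ)) = 1 := by
      rw [← hD]
      calc _ = (V : Matrix ι ι ℂ)ᴴ * (R * ((V : Matrix ι ι ℂ) * (V : Matrix ι ι ℂ)ᴴ) * R) * V := by
            simp only [Matrix.mul_assoc]
        _ = 1 := by rw [hVV', Matrix.mul_one, hRR, Matrix.mul_one, hVV]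
    rw [Matrix.diagonal_mul_diagonal] at h2
    have h3 := congrFun (congrFun h2 i) i
    simp only [Matrix.diagonal_apply_eq, Matrix.one_apply_eq] at h3
    have h4 : hR.eigenvalues i * hR.eigenvalues i = 1 := by exact_mod_cast h3
    exact mul_self_eq_one_iff.mp h4
  have hsum : ∑ i, hR.eigenvalues i = ∑ i, z i := by
    have := hR.trace_eq_sum_eigenvalues
    rw [ht] at this
    apply Complex.ofReal_injective
    push_cast
    exact this.symm
  obtain ⟨σ, hσ⟩ := exists_perm_aux _ z hev hz hsum
  have hU : ((V : Matrix ι ι ℂ).submatrix id σ) * ((V : Matrix ι ι ℂ).submatrix id σ)ᴴ = 1 := by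
    rw [Matrix.conjTranspose_submatrix, Matrix.submatrix_mul_equiv, hVV']
    simp
  refine ⟨(V : Matrix ι ι ℂ).submatrix id σ, ?_, ?_⟩
  · rw [Matrix.mem_unitaryGroup_iff]; exact hU
  · have : Matrix.diagonal (fun i => (z i : ℂ)) =
        (Matrix.diagonal (fun i => (hR.eigenvalues i : ℂ))).submatrix σ σ := by
      rw [Matrix.submatrix_diagonal_equiv]
      congr 1; ext i; simp [hσ]
    rw [this, Matrix.conjTranspose_submatrix, Matrix.submatrix_mul_equiv,
      Matrix.submatrix_mul_equiv, ← hspec]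
    simp

/-- The reindexed state as a diagonal matrix. -/
theorem reindex_rho_aux (n k : ℕ) (h : k ≤ n + 1) (α : ℝ) :
    Matrix.reindex (splitIdx n k h) (splitIdx n k h) (rhoDQC1 n α) =
      (1 / 2 ^ (n + 1) : ℂ) • (1 + (1 - α : ℂ) • Matrix.diagonal
        (fun p => (((if ((splitIdx n k h).symm p).1 = 0 then 1 else -1 : ℝ)) : ℂ))) := by
  ext p q
  obtain ⟨p, rfl⟩ := (splitIdx n k h).surjective p
  obtain ⟨q, rfl⟩ := (splitIdx n k h).surjective q
  obtain ⟨p1, p2⟩ := p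
  obtain ⟨q1, q2⟩ := q
  simp only [rhoDQC1, ket0bra0, Matrix.reindex_apply, Matrix.submatrix_apply,
    Equiv.symm_apply_apply, Matrix.add_apply, Matrix.smul_apply, Matrix.kroneckerMap_apply,
    Matrix.of_apply, Matrix.one_apply, Matrix.diagonal_apply, EmbeddingLike.apply_eq_iff_eq,
    Prod.mk.injEq, smul_eq_mul]
  by_cases h2 : p2 = q2 <;> fin_cases p1 <;> fin_cases q1 <;> simp [h2, pow_succ] <;>
    field_simp <;> ring

theorem PT_aux {A B : Type*} [DecidableEq A] [DecidableEq B] (c d : ℂ)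
    (R : Matrix (A × B) (A × B) ℂ) : PT (c • (1 + d • R)) = c • (1 + d • PT R) := by
  ext p q
  obtain ⟨p1, p2⟩ := p
  obtain ⟨q1, q2⟩ := q
  simp only [PT, Matrix.of_apply, Matrix.smul_apply, Matrix.add_apply, Matrix.one_apply,
    Prod.mk.injEq]
  simp only [eq_comm (a := q1)]

theorem conj_aux {ι : Type*} [Fintype ι] [DecidableEq ι] (U D : Matrix ι ι ℂ)
    (hU : U ∈ Matrix.unitaryGroup ι ℂ) (c d : ℂ) :
    U * (c • (1 + d • D)) * Uᴴ = c • (1 + d • (U * D * Uᴴ)) := by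
  have hU' : U * Uᴴ = 1 := Matrix.mem_unitaryGroup_iff.mp hU
  simp [Matrix.mul_add, Matrix.add_mul, hU']

/-- the lower bound on the partial transpose of a Hermitian unitary -/
theorem PT_bound_aux {A B : Type*} [Fintype A] [Fintype B] [DecidableEq A] [DecidableEq B]
    (R : Matrix (A × B) (A × B) ℂ) (hR : R.IsHermitian) (hRR : R * R = 1) (v : A × B → ℂ) :
    0 ≤ (Fintype.card A : ℂ) * (star v ⬝ᵥ v) + star v ⬝ᵥ (PT R *ᵥ v) := by
  let x : A → A → A × B → ℂ := fun i k p => if p.1 = k then v (i, p.2) else 0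
  have hnn : ∀ w : A × B → ℂ, 0 ≤ star w ⬝ᵥ w := fun w => dotProduct_star_self_nonneg w
  have e1 : ∀ i k, star (x i k + R *ᵥ x k i) ⬝ᵥ (x i k + R *ᵥ x k i) =
      star (x i k) ⬝ᵥ x i k + star (x k i) ⬝ᵥ x k i
        + (star (x i k) ⬝ᵥ (R *ᵥ x k i) + star (x k i) ⬝ᵥ (R *ᵥ x i k)) := by
    intro i k
    have h1 : ∀ y w : A × B → ℂ, star (R *ᵥ y) ⬝ᵥ w = star y ⬝ᵥ (R *ᵥ w) := by
      intro y w
      rw [Matrix.star_mulVec, hR.eq, Matrix.dotProduct_mulVec]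
    rw [star_add, add_dotProduct, dotProduct_add, dotProduct_add, h1, h1, Matrix.mulVec_mulVec,
      hRR, Matrix.one_mulVec]
    ring
  have e2 : ∀ i k, star (x i k) ⬝ᵥ x i k = ∑ b, star (v (i, b)) * v (i, b) := by
    intro i k
    simp only [dotProduct, x, Pi.star_apply, Fintype.sum_prod_type]
    rw [Finset.sum_eq_single k] <;> simp +contextual
  have e3 : ∀ i k, star (x i k) ⬝ᵥ (R *ᵥ x k i) =
      ∑ b, ∑ c, star (v (i, b)) * (R (k, b) (i, c) * v (k, c)) := by
    intro i k
    simp only [dotProduct, Matrix.mulVec, x, Pi.star_apply, Fintype.sum_prod_type]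
    rw [Finset.sum_eq_single k]
    · refine Finset.sum_congr rfl fun b _ => ?_
      rw [Finset.sum_eq_single i]
      · simp [Finset.mul_sum]
      · simp +contextual
      · simp
    · simp +contextual
    · simp
  have e4 : ∑ i, ∑ k, star (x i k) ⬝ᵥ (R *ᵥ x k i) = star v ⬝ᵥ (PT R *ᵥ v) := by
    simp only [e3]
    simp only [dotProduct, Matrix.mulVec, PT, Matrix.of_apply, Pi.star_apply,
      Fintype.sum_prod_type, Finset.mul_sum]
    refine Finset.sum_congr rfl fun i _ => ?_
    rw [Finset.sum_comm]
  have e5 : ∑ i, ∑ k, star (x i k) ⬝ᵥ x i k = (Fintype.card A : ℂ) * (star v ⬝ᵥ v) := by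
    simp only [e2]
    simp only [dotProduct, Pi.star_apply, Fintype.sum_prod_type, Finset.sum_const,
      Finset.card_univ, nsmul_eq_mul, Finset.mul_sum]
  have h0 : 0 ≤ ∑ i, ∑ k, star (x i k + R *ᵥ x k i) ⬝ᵥ (x i k + R *ᵥ x k i) :=
    Finset.sum_nonneg fun i _ => Finset.sum_nonneg fun k _ => hnn _
  simp only [e1, Finset.sum_add_distrib] at h0
  rw [Finset.sum_comm (f := fun i k => star (x k i) ⬝ᵥ x k i),
    Finset.sum_comm (f := fun i k => star (x k i) ⬝ᵥ (R *ᵥ x i k)), e4, e5] at h0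
  have h2 : (0 : ℂ) ≤ 1 / 2 := by
    rw [show (1 / 2 : ℂ) = ((1 / 2 : ℝ) : ℂ) by push_cast; rfl]
    exact_mod_cast (by norm_num : (0 : ℝ) ≤ 1 / 2)
  have := mul_nonneg h2 h0
  ring_nf at this ⊢
  exact this

theorem PT_hermitian_aux {A B : Type*} (R : Matrix (A × B) (A × B) ℂ) (hR : R.IsHermitian) :
    (PT R).IsHermitian := by
  ext p q
  simp only [PT, Matrix.conjTranspose_apply, Matrix.of_apply]
  exact hR.apply _ _

/-- underlying involution -/
def sigAux (K L : ℕ) (h : K < L) (p : Fin K × Fin L) : Fin K × Fin L :=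
  if hj : p.2.1 < K then (⟨p.2.1, hj⟩, ⟨p.1.1, p.1.2.trans h⟩)
  else if p.2.1 = K then p else (Fin.rev p.1, p.2)

def sgnAux (K L : ℕ) (p : Fin K × Fin L) : ℝ := if p.2.1 < K then -1 else 1

theorem sigAux_invol (K L : ℕ) (h : K < L) (p : Fin K × Fin L) :
    sigAux K L h (sigAux K L h p) = p := by
  obtain ⟨⟨i, hi⟩, ⟨j, hj⟩⟩ := p
  by_cases h1 : j < K
  · simp [sigAux, h1, hi]
  · by_cases h2 : j = K
    · simp [sigAux, h2]
    · simp [sigAux, h1, h2]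

theorem sgnAux_sig (K L : ℕ) (h : K < L) (p : Fin K × Fin L) :
    sgnAux K L (sigAux K L h p) = sgnAux K L p := by
  obtain ⟨⟨i, hi⟩, ⟨j, hj⟩⟩ := p
  by_cases h1 : j < K
  · simp [sigAux, sgnAux, h1, hi]
  · by_cases h2 : j = K
    · simp [sigAux, sgnAux, h2]
    · simp [sigAux, sgnAux, h1, h2]

noncomputable def RAux (K L : ℕ) (h : K < L) : Matrix (Fin K × Fin L) (Fin K × Fin L) ℂ :=
  Matrix.of fun p q => if q = sigAux K L h p then (sgnAux K L p : ℂ) else 0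

theorem RAux_herm (K L : ℕ) (h : K < L) : (RAux K L h).IsHermitian := by
  ext p q
  simp only [RAux, Matrix.conjTranspose_apply, Matrix.of_apply]
  have : p = sigAux K L h q ↔ q = sigAux K L h p := by
    constructor <;> (intro e; rw [e, sigAux_invol])
  by_cases e : q = sigAux K L h p
  · rw [if_pos (this.mpr e), if_pos e, e, sgnAux_sig]; simp
  · rw [if_neg (fun c => e (this.mp c)), if_neg e]; simp

theorem RAux_sq (K L : ℕ) (h : K < L) : RAux K L h * RAux K L h = 1 := by
  ext p q
  simp only [RAux, Matrix.mul_apply, Matrix.of_apply, ite_mul, zero_mul, Finset.sum_ite_eq',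
    Finset.mem_univ, if_true, sigAux_invol, sgnAux_sig, Matrix.one_apply]
  simp only [eq_comm (a := q), mul_ite, mul_zero]
  congr 1
  have : sgnAux K L p * sgnAux K L p = 1 := by unfold sgnAux; split_ifs <;> norm_num
  exact_mod_cast this

theorem RAux_trace (K L : ℕ) (h : K < L) (hK : Even K) : (RAux K L h).trace = 0 := by
  simp only [Matrix.trace, Matrix.diag_apply, RAux, Matrix.of_apply, Fintype.sum_prod_type]
  refine Finset.sum_eq_zero fun i _ => ?_
  have : ∀ j : Fin L, (if (i, j) = sigAux K L h (i, j) then (sgnAux K L (i, j) : ℂ) else 0) =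
      (if j = ⟨K, h⟩ then 1 else 0) - (if j = ⟨i.1, i.2.trans h⟩ then 1 else 0) := by
    intro j
    obtain ⟨i, hi⟩ := i
    obtain ⟨j, hj⟩ := j
    have hi' : i ≠ K := hi.ne
    by_cases h1 : j < K
    · have : j ≠ K := h1.ne
      by_cases h3 : j = i
      · subst h3; simp [sigAux, sgnAux, h1, this]
      · have h4 : i ≠ j := fun e => h3 e.symm
        simp [sigAux, sgnAux, h1, h3, this, h4]
    · by_cases h2 : j = K
      · have h5 : K ≠ i := fun e => hi' e.symm
        simp [sigAux, sgnAux, h2, h5]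
      · have h3 : j ≠ i := by omega
        have h4 : (⟨i, hi⟩ : Fin K) ≠ Fin.rev ⟨i, hi⟩ := by
          intro e
          have := congrArg Fin.val e
          rw [Fin.val_rev] at this
          obtain ⟨m, hm⟩ := hK
          simp only at this
          omega
        simp [sigAux, h1, h2, h3, h4]
  simp [this]

theorem RAux_val (K L : ℕ) (h : K < L) :
    let v : Fin K × Fin L → ℂ := fun p => if p.2 = Fin.castLE h.le p.1 then 1 else 0
    star v ⬝ᵥ v = (K : ℂ) ∧ star v ⬝ᵥ (PT (RAux K L h) *ᵥ v) = -(K : ℂ) ^ 2 := by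
  intro v
  constructor
  · simp [v, dotProduct, Fintype.sum_prod_type]
  · have : ∀ i j : Fin K, RAux K L h (j, Fin.castLE h.le i) (i, Fin.castLE h.le j) = -1 := by
      intro i j
      simp [RAux, sigAux, sgnAux, Fin.ext_iff]
    simp [v, dotProduct, Matrix.mulVec, Fintype.sum_prod_type, PT, this, sq]

theorem sum_z_aux (n k : ℕ) (h : k ≤ n + 1) :
    ∑ p, (((if ((splitIdx n k h).symm p).1 = 0 then 1 else -1 : ℝ)) : ℂ) = 0 := by
  rw [(splitIdx n k h).symm.sum_comp
    (fun q : Fin 2 × Fin (2 ^ n) => ((if q.1 = 0 then 1 else -1 : ℝ) : ℂ))]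
  simp [Fintype.sum_prod_type]

/-- for `1 ≤ k < (n+1)/2` and `0 ≤ α ≤ 1`, the DQC1 state `ρᵅₙ` is PPT
from spectrum for the `2ᵏ : 2ⁿ⁺¹⁻ᵏ` bipartition iff `α ≥ 1 − 1/2ᵏ`. -/
theorem stmt9 (n k : ℕ) (hk1 : 1 ≤ k) (hk2 : 2 * k < n + 1)
    (α : ℝ) (h0 : 0 ≤ α) (h1 : α ≤ 1) :
    (∀ U ∈ Matrix.unitaryGroup (Fin (2 ^ k) × Fin (2 ^ (n + 1 - k))) ℂ,
        (PT (U * (Matrix.reindex (splitIdx n k (by omega)) (splitIdx n k (by omega))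
            (rhoDQC1 n α)) * Uᴴ)).PosSemidef) ↔
      1 - 1 / 2 ^ k ≤ α := by
  have hKpos : (0 : ℝ) < 2 ^ k := by positivity
  have hc : (0 : ℂ) < 1 / 2 ^ (n + 1) := by
    rw [show (1 / 2 ^ (n + 1) : ℂ) = ((1 / 2 ^ (n + 1) : ℝ) : ℂ) by push_cast; rfl]
    exact_mod_cast (by positivity : (0 : ℝ) < 1 / 2 ^ (n + 1))
  have hz : ∀ p, (if ((splitIdx n k (by omega)).symm p).1 = 0 then 1 else -1 : ℝ) = 1 ∨
      (if ((splitIdx n k (by omega)).symm p).1 = 0 then 1 else -1 : ℝ) = -1 := by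
    intro p; split_ifs <;> simp
  rw [reindex_rho_aux n k (by omega) α]
  have hs := sum_z_aux n k (by omega)
  generalize hzz : (fun p => (if ((splitIdx n k (by omega)).symm p).1 = 0 then 1 else -1 : ℝ)) = z
    at *
  have hzz' : ∀ p, (if ((splitIdx n k (by omega)).symm p).1 = 0 then 1 else -1 : ℝ) = z p :=
    fun p => congrFun hzz p
  simp only [hzz'] at hz hs ⊢
  clear hzz hzz'
  constructor
  · intro H
    have hlt : 2 ^ k < 2 ^ (n + 1 - k) := Nat.pow_lt_pow_right (by norm_num) (by omega)
    obtain ⟨U, hU, hUR⟩ := exists_unitary_aux (RAux (2 ^ k) (2 ^ (n + 1 - k)) hlt)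
      (RAux_herm _ _ _) (RAux_sq _ _ _) z hz (by
        rw [RAux_trace _ _ _ ((Nat.even_pow.mpr ⟨even_two, by omega⟩)), hs])
    have h := H U hU
    rw [conj_aux U _ hU, hUR, PT_aux] at h
    obtain ⟨hv1, hv2⟩ := RAux_val (2 ^ k) (2 ^ (n + 1 - k)) hlt
    have h2 := h.dotProduct_mulVec_nonneg (fun p : Fin (2 ^ k) × Fin (2 ^ (n + 1 - k)) =>
      if p.2 = Fin.castLE hlt.le p.1 then 1 else 0)
    rw [Matrix.smul_mulVec, Matrix.add_mulVec, Matrix.smul_mulVec, Matrix.one_mulVec,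
      dotProduct_smul, dotProduct_add, dotProduct_smul, hv1, hv2, smul_eq_mul, smul_eq_mul] at h2
    have h3 : (0 : ℝ) ≤ 1 / 2 ^ (n + 1) * (2 ^ k + (1 - α) * -(2 ^ k) ^ 2) := by
      rw [← Complex.zero_le_real]
      push_cast at h2 ⊢
      exact h2
    have h4 : (0 : ℝ) ≤ 2 ^ k + (1 - α) * -(2 ^ k) ^ 2 :=
      (mul_nonneg_iff_of_pos_left (by positivity)).mp h3
    have h5 : (0 : ℝ) ≤ 1 - (1 - α) * 2 ^ k := by
      by_contra hcon
      push Not at hcon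
      nlinarith
    have h6 : (1 - α) ≤ 1 / 2 ^ k := by rw [le_div_iff₀ hKpos]; linarith
    linarith
  · intro hα U hU
    rw [conj_aux U _ hU, PT_aux]
    have hU1 : U * Uᴴ = 1 := Matrix.mem_unitaryGroup_iff.mp hU
    have hU2 : Uᴴ * U = 1 := Matrix.mem_unitaryGroup_iff'.mp hU
    set D := Matrix.diagonal (fun p => (z p : ℂ)) with hD
    have hDD : D * D = 1 := by
      rw [hD, Matrix.diagonal_mul_diagonal, ← Matrix.diagonal_one]
      congr 1; ext p
      rcases hz p with h | h <;> rw [h] <;> norm_num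
    have hDh : Dᴴ = D := by
      rw [hD, Matrix.diagonal_conjTranspose]
      congr 1; ext p; simp
    set R := U * D * Uᴴ with hRdef
    have hR : R.IsHermitian := by
      rw [Matrix.IsHermitian, hRdef]
      simp [Matrix.conjTranspose_mul, hDh, Matrix.mul_assoc]
    have hRR : R * R = 1 := by
      calc R * R = U * (D * (Uᴴ * U) * D) * Uᴴ := by simp only [hRdef, Matrix.mul_assoc]
        _ = 1 := by rw [hU2, Matrix.mul_one, hDD, Matrix.mul_one, hU1]
    have hreal : (1 - α : ℂ) = ((1 - α : ℝ) : ℂ) := by push_cast; rfl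
    refine Matrix.PosSemidef.smul ?_ hc.le
    refine Matrix.PosSemidef.of_dotProduct_mulVec_nonneg ?_ fun v => ?_
    · refine Matrix.isHermitian_one.add ?_
      rw [Matrix.IsHermitian, Matrix.conjTranspose_smul, (PT_hermitian_aux R hR).eq, hreal]
      simp
    · have hb := PT_bound_aux R hR hRR v
      have hvv : 0 ≤ star v ⬝ᵥ v := dotProduct_star_self_nonneg v
      rw [Matrix.add_mulVec, Matrix.smul_mulVec, Matrix.one_mulVec, dotProduct_add,
        dotProduct_smul, smul_eq_mul]
      rw [Fintype.card_fin] at hb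
      have ha : (0 : ℂ) ≤ ((1 - α : ℝ) : ℂ) := by exact_mod_cast (by linarith : 0 ≤ 1 - α)
      have hb2 : (0 : ℂ) ≤ ((1 - (1 - α) * 2 ^ k : ℝ) : ℂ) := by
        have h6 : (1 - α) ≤ 1 / 2 ^ k := by linarith
        rw [le_div_iff₀ hKpos] at h6
        exact_mod_cast (by linarith : 0 ≤ 1 - (1 - α) * 2 ^ k)
      have := add_nonneg (mul_nonneg ha hb) (mul_nonneg hb2 hvv)
      convert this using 1
      push_cast
      ring
end

section
/- Let n ≥ 2 and 0 ≤ α ≤ 1, and say that ρ^α_n is PPT from spectrum for all bipartitions if for every k with 1 ≤ k ≤ (n+1)/2 and every unitary U on ℂ^{2^{n+1}}, the partial transpose of U ρ^α_n U† on the first factor of the bipartition ℂ^{2^k} ⊗ ℂ^{2^{n+1−k}} is positive semidefinite. Then: (a) if α ≥ 1 − 1/2^{⌊(n+1)/2⌋}, then ρ^α_n is PPT from spectrum for all bipartitions; (b) if ρ^α_n is PPT from spectrum for all bipartitions, then α ≥ 1 − 1/2^{⌊n/2⌋}. -/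
open Matrix Kronecker
open scoped ComplexOrder

/-- `ρᵅₙ` is PPT from spectrum for all bipartitions: for every `k` with
`1 ≤ k ≤ (n+1)/2` and every unitary `U`, the partial transpose of `U ρᵅₙ U†`
on the first factor of `ℂ^{2ᵏ} ⊗ ℂ^{2ⁿ⁺¹⁻ᵏ}` is positive semidefinite. -/
def PPTFromSpectrumAll (n : ℕ) (α : ℝ) : Prop :=
  ∀ k, 1 ≤ k → ∀ hk : 2 * k ≤ n + 1,
    ∀ U ∈ Matrix.unitaryGroup (Fin (2 ^ k) × Fin (2 ^ (n + 1 - k))) ℂ,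
      (PT (U * (Matrix.reindex (splitIdx n k (by omega)) (splitIdx n k (by omega))
          (rhoDQC1 n α)) * Uᴴ)).PosSemidef

lemma PT_posSemidef_aux {A B : Type*} [Fintype A] [Fintype B] [DecidableEq A] [DecidableEq B]
    (S : Matrix (A × B) (A × B) ℂ) (hS : Sᴴ = S) (hSS : S * S = 1) (c : ℝ) (hc : 0 ≤ c)
    (hcd : c * Fintype.card A ≤ 1) :
    (PT (1 + (c : ℂ) • S)).PosSemidef := by
  have hentry : ∀ p q, star (S p q) = S q p := fun p q => by
    conv_rhs => rw [← hS]
    rfl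
  have hPT : PT (1 + (c : ℂ) • S) = 1 + (c : ℂ) • PT S := by
    ext ⟨i, j⟩ ⟨k, l⟩
    simp only [PT, Matrix.of_apply, Matrix.add_apply, Matrix.smul_apply, Matrix.one_apply,
      Prod.mk.injEq]
    congr 1
    simp [eq_comm]
  have hherm : (PT (1 + (c : ℂ) • S)).IsHermitian := by
    rw [hPT]
    ext ⟨i, j⟩ ⟨k, l⟩
    have := hentry (i, l) (k, j)
    simp only [PT, Matrix.of_apply, Matrix.conjTranspose_apply, Matrix.add_apply,
      Matrix.smul_apply, Matrix.one_apply, star_add, star_smul, this]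
    simp [apply_ite, eq_comm, and_comm]
  refine Matrix.PosSemidef.of_dotProduct_mulVec_nonneg hherm fun v => ?_
  set x : A → A → (A × B) → ℂ := fun i k p => if p.1 = k then v (i, p.2) else 0 with hx
  set N : ℂ := star v ⬝ᵥ v with hN
  set q : ℂ := star v ⬝ᵥ (PT S *ᵥ v) with hq
  have e1 : ∑ i, ∑ k, star (x i k) ⬝ᵥ (S *ᵥ x k i) = q := by
    simp only [hq, hx, PT, dotProduct, mulVec, Fintype.sum_prod_type, Matrix.of_apply,
      Pi.star_apply, apply_ite star, star_zero, ite_mul, zero_mul, mul_ite, mul_zero]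
    refine Finset.sum_congr rfl fun i _ => ?_
    rw [Finset.sum_comm' (t' := Finset.univ) (s' := fun _ => Finset.univ) (by simp)]
    simp only [Finset.sum_ite_irrel, Finset.sum_const_zero, Finset.sum_ite_eq', Finset.sum_ite_eq, Finset.mem_univ, if_true]
    rw [Finset.sum_comm]
    simp only [Finset.mul_sum]
  have e2 : ∑ i, ∑ k, star (x i k) ⬝ᵥ x i k = Fintype.card A * N := by
    simp only [hN, hx, dotProduct, Fintype.sum_prod_type, 
      Pi.star_apply, apply_ite star, star_zero, ite_mul, zero_mul, mul_ite, mul_zero]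
    simp [Finset.mul_sum, Finset.sum_ite_irrel]
  have e2' : ∑ i, ∑ k, star (x k i) ⬝ᵥ x k i = Fintype.card A * N := by
    rw [Finset.sum_comm, e2]
  have e1' : ∑ i, ∑ k, star (x k i) ⬝ᵥ (S *ᵥ x i k) = q := by
    rw [Finset.sum_comm, e1]
  have hpos : 0 ≤ ∑ i, ∑ k, star (x i k + S *ᵥ x k i) ⬝ᵥ (x i k + S *ᵥ x k i) :=
    Finset.sum_nonneg fun i _ => Finset.sum_nonneg fun k _ => dotProduct_star_self_nonneg _
  have hexp : ∀ i k, star (x i k + S *ᵥ x k i) ⬝ᵥ (x i k + S *ᵥ x k i) =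
      star (x i k) ⬝ᵥ x i k + star (x k i) ⬝ᵥ x k i + star (x i k) ⬝ᵥ (S *ᵥ x k i)
        + star (x k i) ⬝ᵥ (S *ᵥ x i k) := by
    intro i k
    rw [star_add, add_dotProduct, dotProduct_add, dotProduct_add, Matrix.star_mulVec, hS,
      ← Matrix.dotProduct_mulVec, ← Matrix.dotProduct_mulVec, Matrix.mulVec_mulVec, hSS,
      Matrix.one_mulVec]
    ring
  simp only [hexp, Finset.sum_add_distrib, e1, e2, e1', e2'] at hpos
  have hN0 : 0 ≤ N := dotProduct_star_self_nonneg _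
  rw [hPT, Matrix.add_mulVec, Matrix.one_mulVec, Matrix.smul_mulVec, dotProduct_add,
    dotProduct_smul, ← hN, ← hq, smul_eq_mul]
  have h2 : 0 ≤ (((1 - c * Fintype.card A : ℝ)) : ℂ) * N :=
    mul_nonneg (by exact_mod_cast sub_nonneg.2 hcd) hN0
  have h3 : 0 ≤ ((c / 2 : ℝ) : ℂ) * (Fintype.card A * N + Fintype.card A * N + q + q) :=
    mul_nonneg (by exact_mod_cast (by positivity : 0 ≤ c / 2)) hpos
  have := add_nonneg h2 h3
  convert this using 1
  push_cast
  ring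

def Zm : Matrix (Fin 2) (Fin 2) ℂ := !![1, 0; 0, -1]
noncomputable def Pm : Matrix (Fin 2) (Fin 2) ℂ := !![1/2, 1/2; 1/2, 1/2]
noncomputable def Qm : Matrix (Fin 2) (Fin 2) ℂ := !![1/2, -1/2; -1/2, 1/2]

lemma rho_eq (n : ℕ) (α : ℝ) : rhoDQC1 n α = ((1 / 2 ^ (n + 1) : ℝ) : ℂ) •
    (1 + ((1 - α : ℝ) : ℂ) • (Zm ⊗ₖ (1 : Matrix (Fin (2 ^ n)) (Fin (2 ^ n)) ℂ))) := by
  ext ⟨i, j⟩ ⟨k, l⟩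
  have : (2 : ℂ) ^ n ≠ 0 := by positivity
  by_cases hjl : j = l
  · fin_cases i <;> fin_cases k <;>
      simp [rhoDQC1, ket0bra0, Zm, Matrix.one_apply, hjl] <;> field_simp <;> ring
  · simp [rhoDQC1, ket0bra0, Zm, Matrix.one_apply, hjl]

lemma PT_smul {A B : Type*} (c : ℂ) (M : Matrix (A × B) (A × B) ℂ) : PT (c • M) = c • PT M := rfl

lemma part_a (n : ℕ) (α : ℝ) (h1 : α ≤ 1)
    (h : (1 : ℝ) - 1 / 2 ^ ((n + 1) / 2) ≤ α) : PPTFromSpectrumAll n α := by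
  intro k hk1 hk U hU
  have hUU : U * Uᴴ = 1 := (Matrix.mem_unitaryGroup_iff).1 hU
  have hUU' : Uᴴ * U = 1 := (Matrix.mem_unitaryGroup_iff').1 hU
  set e := splitIdx n k (by omega)
  set S0 := (Zm ⊗ₖ (1 : Matrix (Fin (2 ^ n)) (Fin (2 ^ n)) ℂ)) with hS0
  have hZ : Zm * Zm = 1 := by ext i j; fin_cases i <;> fin_cases j <;> simp [Zm]
  have hZh : Zmᴴ = Zm := by ext i j; fin_cases i <;> fin_cases j <;> simp [Zm]
  have hS0S : S0 * S0 = 1 := by rw [hS0, ← Matrix.mul_kronecker_mul, hZ]; simp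
  have hS0h : S0ᴴ = S0 := by rw [hS0, Matrix.conjTranspose_kronecker, hZh]; simp
  set S1 := Matrix.reindex e e S0 with hS1
  have hS1S : S1 * S1 = 1 := by
    simp only [hS1, Matrix.reindex_apply, Matrix.submatrix_mul_equiv, hS0S]
    simp
  have hS1h : S1ᴴ = S1 := by
    rw [hS1, Matrix.conjTranspose_reindex, hS0h]
  have key : U * (Matrix.reindex e e (rhoDQC1 n α)) * Uᴴ = ((1 / 2 ^ (n + 1) : ℝ) : ℂ) •
      (1 + ((1 - α : ℝ) : ℂ) • (U * S1 * Uᴴ)) := by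
    have : Matrix.reindex e e (rhoDQC1 n α) = ((1 / 2 ^ (n + 1) : ℝ) : ℂ) •
      (1 + ((1 - α : ℝ) : ℂ) • S1) := by
      rw [rho_eq, ← hS0, hS1]
      ext p q
      simp only [Matrix.reindex_apply, Matrix.submatrix_apply, Matrix.smul_apply,
        Matrix.add_apply, Matrix.one_apply, EmbeddingLike.apply_eq_iff_eq]
    rw [this]
    simp only [Matrix.mul_smul, Matrix.smul_mul, mul_add, add_mul, mul_one, hUU]
  rw [key, PT_smul]
  refine Matrix.PosSemidef.smul (PT_posSemidef_aux _ ?_ ?_ _ (by linarith) ?_) ?_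
  · simp [Matrix.conjTranspose_mul, hS1h, Matrix.mul_assoc]
  · calc U * S1 * Uᴴ * (U * S1 * Uᴴ) = U * S1 * (Uᴴ * U) * S1 * Uᴴ := by
          simp only [Matrix.mul_assoc]
      _ = 1 := by rw [hUU', mul_one, Matrix.mul_assoc U, hS1S, mul_one, hUU]
  · have hle : (2 : ℝ) ^ k ≤ 2 ^ ((n + 1) / 2) :=
      pow_le_pow_right₀ (by norm_num) (by omega)
    have hp : (0 : ℝ) < 2 ^ ((n + 1) / 2) := by positivity
    simp only [Fintype.card_fin, Nat.cast_pow, Nat.cast_ofNat]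
    calc (1 - α) * 2 ^ k ≤ (1 / 2 ^ ((n + 1) / 2)) * 2 ^ ((n + 1) / 2) := by
          apply mul_le_mul (by linarith) hle (by positivity) (by positivity)
      _ = 1 := by field_simp
  · have : (0 : ℝ) ≤ 1 / 2 ^ (n + 1) := by positivity
    exact_mod_cast this

/-- Controlled-swap type unitary conjugating `Z ⊗ 1` into `Z ⊗ T`. -/
lemma exists_V {Y : Type*} [Fintype Y] [DecidableEq Y] (T : Matrix Y Y ℂ) (hT : Tᴴ = T)
    (hTT : T * T = 1) : ∃ V : Matrix (Fin 2 × Y) (Fin 2 × Y) ℂ, V * Vᴴ = 1 ∧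
      V * (Zm ⊗ₖ (1 : Matrix Y Y ℂ)) * Vᴴ = Zm ⊗ₖ T := by
  have hPP : Pm * Pm = Pm := by
    ext i j; fin_cases i <;> fin_cases j <;> norm_num [Pm]
  have hQQ : Qm * Qm = Qm := by
    ext i j; fin_cases i <;> fin_cases j <;> norm_num [Qm]
  have hPQ : Pm * Qm = 0 := by
    ext i j; fin_cases i <;> fin_cases j <;> norm_num [Pm, Qm]
  have hQP : Qm * Pm = 0 := by
    ext i j; fin_cases i <;> fin_cases j <;> norm_num [Pm, Qm]
  have hPZ : Pm * Zm = Zm * Qm := by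
    ext i j; fin_cases i <;> fin_cases j <;> norm_num [Pm, Qm, Zm]
  have hQZ : Qm * Zm = Zm * Pm := by
    ext i j; fin_cases i <;> fin_cases j <;> norm_num [Pm, Qm, Zm]
  have hs : Pm + Qm = 1 := by
    ext i j; fin_cases i <;> fin_cases j <;> norm_num [Pm, Qm]
  have hPh : Pmᴴ = Pm := by
    ext i j; fin_cases i <;> fin_cases j <;> simp [Pm]
  have hQh : Qmᴴ = Qm := by
    ext i j; fin_cases i <;> fin_cases j <;> simp [Qm]
  refine ⟨Pm ⊗ₖ 1 + Qm ⊗ₖ T, ?_, ?_⟩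
  · simp only [Matrix.conjTranspose_add, Matrix.conjTranspose_kronecker, hPh, hQh, hT,
      Matrix.conjTranspose_one, mul_add, add_mul, ← Matrix.mul_kronecker_mul, hPP, hQQ, hPQ,
      hQP, hTT, Matrix.zero_kronecker, mul_one, one_mul, add_zero, zero_add]
    rw [← Matrix.add_kronecker, hs, Matrix.one_kronecker_one]
  · simp only [Matrix.conjTranspose_add, Matrix.conjTranspose_kronecker, hPh, hQh, hT,
      Matrix.conjTranspose_one, mul_add, add_mul, ← Matrix.mul_kronecker_mul, hPZ, hQZ,
      Matrix.mul_assoc, hPP, hQQ, hPQ,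
      hQP, hTT, Matrix.zero_kronecker, mul_zero, mul_one, one_mul, add_zero, zero_add]
    rw [← Matrix.add_kronecker, ← mul_add, hs, mul_one]

lemma part_b (n : ℕ) (hn : 2 ≤ n) (α : ℝ) (h : PPTFromSpectrumAll n α) :
    (1 : ℝ) - 1 / 2 ^ (n / 2) ≤ α := by
  set m := n / 2 with hm
  have h' := h m (by omega) (by omega)
  set e := splitIdx n m (by omega)
  obtain ⟨r, hr⟩ : ∃ r, n = 2 * m + r := ⟨n - 2 * m, by omega⟩
  let D := Fin (2 ^ m)
  let R := Fin (2 ^ r)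
  let g : Fin (2 ^ n) ≃ (D × D) × R := Fintype.equivOfCardEq (by
    simp only [D, R, Fintype.card_prod, Fintype.card_fin, ← pow_add]; congr 1; omega)
  let f : D × (Fin 2 × R) ≃ Fin (2 ^ (n + 1 - m)) := Fintype.equivOfCardEq (by
    simp only [D, R, Fintype.card_prod, Fintype.card_fin]
    rw [show n + 1 - m = m + (1 + r) by omega, pow_add, pow_add, pow_one])
  let r0 : R := ⟨0, by positivity⟩
  let τ : Fin (2 ^ n) → Fin (2 ^ n) := fun y => g.symm ((g y).1.swap, (g y).2)
  have hττ : ∀ y, τ (τ y) = y := fun y => by simp [τ]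
  let T : Matrix (Fin (2 ^ n)) (Fin (2 ^ n)) ℂ := Matrix.of fun y y' => if τ y = y' then 1 else 0
  have hsym : ∀ y y', τ y = y' ↔ τ y' = y := fun y y' =>
    ⟨fun h => by rw [← h, hττ], fun h => by rw [← h, hττ]⟩
  have hT : Tᴴ = T := by
    ext y y'
    simp [T, Matrix.conjTranspose_apply, apply_ite, hsym y y']
  have hTT : T * T = 1 := by
    ext y y'
    simp only [T, Matrix.mul_apply, Matrix.one_apply, Matrix.of_apply, ite_mul, one_mul, zero_mul,
      Finset.sum_ite_eq, Finset.mem_univ, if_true, hττ]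
  obtain ⟨V, hV, hVZ⟩ := exists_V T hT hTT
  let e2 : (Fin 2 × Fin (2 ^ n)) ≃ (D × Fin (2 ^ (n + 1 - m))) :=
    { toFun := fun x => ((g x.2).1.1, f ((g x.2).1.2, (x.1, (g x.2).2)))
      invFun := fun p => ((f.symm p.2).2.1, g.symm ((p.1, (f.symm p.2).1), (f.symm p.2).2.2))
      left_inv := fun x => by simp
      right_inv := fun p => by simp }
  have hU := h' (V.submatrix e2.symm e.symm) (by
    rw [Matrix.mem_unitaryGroup_iff, Matrix.star_eq_conjTranspose,
      Matrix.conjTranspose_submatrix, Matrix.submatrix_mul_equiv, hV]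
    simp)
  have key : V.submatrix e2.symm e.symm * (Matrix.reindex e e (rhoDQC1 n α)) *
      (V.submatrix e2.symm e.symm)ᴴ = (((1 / 2 ^ (n + 1) : ℝ) : ℂ) •
      (1 + ((1 - α : ℝ) : ℂ) • (Zm ⊗ₖ T))).submatrix e2.symm e2.symm := by
    rw [Matrix.reindex_apply, Matrix.conjTranspose_submatrix, Matrix.submatrix_mul_equiv,
      Matrix.submatrix_mul_equiv, rho_eq]
    simp only [Matrix.mul_smul, Matrix.smul_mul, mul_add, add_mul, mul_one, hV, hVZ]
  rw [key] at hU
  let ι : D → D × Fin (2 ^ (n + 1 - m)) := fun a => (a, f (a, (1, r0)))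
  have hsub := (hU.submatrix ι).dotProduct_mulVec_nonneg (fun _ => 1)
  have hent : ∀ a c : D, ((PT ((((1 / 2 ^ (n + 1) : ℝ) : ℂ) •
      (1 + ((1 - α : ℝ) : ℂ) • (Zm ⊗ₖ T))).submatrix e2.symm e2.symm)).submatrix ι ι) a c =
      ((1 / 2 ^ (n + 1) : ℝ) : ℂ) * ((if a = c then 1 else 0) - ((1 - α : ℝ) : ℂ)) := by
    intro a c
    simp [PT, ι, e2, Zm, T, τ, Matrix.one_apply]
    by_cases hac : a = c
    · simp [hac]; ring
    · simp [hac]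
  simp only [dotProduct, mulVec, hent, Pi.star_apply, star_one, one_mul, mul_one,
    ← Finset.mul_sum, Finset.sum_sub_distrib, Finset.sum_ite_eq, Finset.mem_univ, if_true,
    Finset.sum_const, Finset.card_univ] at hsub
  have hD : Fintype.card D = 2 ^ m := Fintype.card_fin _
  rw [hD] at hsub
  have hsub' : (0 : ℝ) ≤ 1 / 2 ^ (n + 1) * (2 ^ m - 2 ^ m * (2 ^ m * (1 - α))) := by
    simp only [nsmul_eq_mul] at hsub
    push_cast at hsub
    rw [← Complex.zero_le_real]
    push_cast
    simpa using hsub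
  have hp : (0 : ℝ) < 2 ^ m := by positivity
  have h3 := nonneg_of_mul_nonneg_right hsub' (by positivity)
  have h4 : 0 ≤ (2 : ℝ) ^ m * (1 - 2 ^ m * (1 - α)) := by linarith
  have h5 := nonneg_of_mul_nonneg_right h4 hp
  have h6 : 1 - α ≤ 1 / 2 ^ m := by
    rw [le_div_iff₀ hp]; linarith
  linarith

/-- for `n ≥ 2` and `0 ≤ α ≤ 1`:
(a) if `α ≥ 1 − 1/2^⌊(n+1)/2⌋` then `ρᵅₙ` is PPT from spectrum for all bipartitions;
(b) if `ρᵅₙ` is PPT from spectrum for all bipartitions then `α ≥ 1 − 1/2^⌊n/2⌋`. -/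
theorem stmt10 (n : ℕ) (hn : 2 ≤ n) (α : ℝ) (h0 : 0 ≤ α) (h1 : α ≤ 1) :
    ((1 : ℝ) - 1 / 2 ^ ((n + 1) / 2) ≤ α → PPTFromSpectrumAll n α) ∧
    (PPTFromSpectrumAll n α → (1 : ℝ) - 1 / 2 ^ (n / 2) ≤ α) := by
  exact ⟨part_a n α h1, part_b n hn α⟩
end
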